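/- Let d ≥ 1 and α ∈ (0,2). There exists a constant C = C(d,α) ≥ 1 such that for all t > 0 and all (x,v) ∈ ℝ^d × ℝ^d, p_t(x,v) ≤ C · t^{−2d/α − d} · 𝒩_{d+α}(t^{−1/α−1} x, t^{−1/α} v). -/

import Mathlib

open MeasureTheory Real RealInnerProductSpace

/-- The kinetic heat kernel of `Δ_v^{α/2} + v·∇_x`, via its Fourier integral. -/
noncomputable def kinHeat (d : ℕ) (α t : ℝ) (x v : EuclideanSpace ℝ (Fin d)) : ℝ :=
  (2 * π) ^ (-(2 * (d : ℝ))) *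
    ∫ w : EuclideanSpace ℝ (Fin d) × EuclideanSpace ℝ (Fin d),
      Real.cos (⟪x, w.1⟫ + ⟪v, w.2⟫) *
        Real.exp (-∫ s in (0 : ℝ)..t, ‖s • w.1 + w.2‖ ^ α)

/-- The function `𝒩_β`. -/
noncomputable def kinN (d : ℕ) (β : ℝ) (x v : EuclideanSpace ℝ (Fin d)) : ℝ :=
  (1 + Real.sqrt (‖x‖ ^ 2 + ‖v‖ ^ 2)) ^ (-(1 + β)) *
    (1 + ⨅ s : Set.Icc (0 : ℝ) 1, ‖x - (s : ℝ) • v‖) ^ (1 - β)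

open scoped ENNReal NNReal

set_option linter.unusedSectionVars false

section JumpSeries

variable {V : Type*} [NormedAddCommGroup V] [MeasurableSpace V] [BorelSpace V]
  [SecondCountableTopology V]

/-- The convolution of `f` with the measure `ν`. -/
noncomputable def jumpOp (ν : Measure V) (f : V → ℝ≥0∞) (z : V) : ℝ≥0∞ :=
  ∫⁻ y, f (z - y) ∂ν

/-- The iterated convolution of `f` with `n` copies of `ν`. -/
noncomputable def jumpIter (ν : Measure V) (f : V → ℝ≥0∞) : ℕ → V → ℝ≥0∞
  | 0 => f
  | n + 1 => jumpOp ν (jumpIter ν f n)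

/-- The convolution of `f` with the convolution exponential of `ν`. -/
noncomputable def jumpSeries (ν : Measure V) (f : V → ℝ≥0∞) (z : V) : ℝ≥0∞ :=
  ∑' n : ℕ, (n.factorial : ℝ≥0∞)⁻¹ * jumpIter ν f n z

lemma measurable_jumpOp (ν : Measure V) [SFinite ν] {f : V → ℝ≥0∞} (hf : Measurable f) :
    Measurable (jumpOp ν f) := by
  unfold jumpOp
  have : Measurable (fun p : V × V => f (p.1 - p.2)) := by fun_prop
  exact this.lintegral_prod_right'

lemma measurable_jumpIter (ν : Measure V) [SFinite ν] {f : V → ℝ≥0∞} (hf : Measurable f) (n : ℕ) :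
    Measurable (jumpIter ν f n) := by
  induction n with
  | zero => exact hf
  | succ n ih => exact measurable_jumpOp ν ih

lemma measurable_jumpSeries (ν : Measure V) [SFinite ν] {f : V → ℝ≥0∞} (hf : Measurable f) :
    Measurable (jumpSeries ν f) :=
  Measurable.tsum fun n => (measurable_jumpIter ν hf n).const_mul _

lemma jumpOp_mono {ν : Measure V} {f g : V → ℝ≥0∞} (h : ∀ z, f z ≤ g z) (z : V) :
    jumpOp ν f z ≤ jumpOp ν g z :=
  lintegral_mono fun _ => h _

lemma jumpOp_comm (μ ν : Measure V) [SFinite μ] [SFinite ν] {f : V → ℝ≥0∞} (hf : Measurable f)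
    (z : V) : jumpOp μ (jumpOp ν f) z = jumpOp ν (jumpOp μ f) z := by
  unfold jumpOp
  rw [lintegral_lintegral_swap]
  · simp_rw [sub_right_comm]
  · have : Measurable (fun p : V × V => f (z - p.1 - p.2)) := by fun_prop
    exact this.aemeasurable

lemma jumpOp_add_measure (μ ν : Measure V) (f : V → ℝ≥0∞) (z : V) :
    jumpOp (μ + ν) f z = jumpOp μ f z + jumpOp ν f z := lintegral_add_measure _ _ _

lemma jumpOp_add_right (ν : Measure V) {f g : V → ℝ≥0∞} (hf : Measurable f) (z : V) :
    jumpOp ν (fun x => f x + g x) z = jumpOp ν f z + jumpOp ν g z := by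
  unfold jumpOp
  rw [lintegral_add_left]
  fun_prop

lemma jumpOp_const_mul (ν : Measure V) (c : ℝ≥0∞) {f : V → ℝ≥0∞} (hf : Measurable f) (z : V) :
    jumpOp ν (fun x => c * f x) z = c * jumpOp ν f z := by
  unfold jumpOp
  rw [lintegral_const_mul]
  fun_prop

lemma jumpOp_jumpSeries (μ ν : Measure V) [SFinite ν] {f : V → ℝ≥0∞} (hf : Measurable f) (z : V) :
    jumpOp μ (jumpSeries ν f) z = ∑' n : ℕ, (n.factorial : ℝ≥0∞)⁻¹ * jumpOp μ (jumpIter ν f n) z := by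
  unfold jumpOp jumpSeries
  have hm := fun n => measurable_jumpIter ν hf n
  rw [lintegral_tsum]
  · congr 1; ext n
    rw [lintegral_const_mul]
    have := hm n
    fun_prop
  · intro n
    have := hm n
    fun_prop

lemma jumpIter_add_le (μ ν : Measure V) [SFinite μ] [SFinite ν] {f : V → ℝ≥0∞} (hf : Measurable f)
    (n : ℕ) (z : V) :
    jumpIter (μ + ν) f (n + 1) z
      ≤ jumpIter μ f (n + 1) z + (n + 1 : ℕ) * jumpOp ν (jumpIter (μ + ν) f n) z := by
  induction n generalizing z with
  | zero => simp [jumpIter, jumpOp_add_measure]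
  | succ n ih =>
    have h1 := measurable_jumpIter μ hf (n + 1)
    have h2 := measurable_jumpIter (μ + ν) hf n
    rw [jumpIter, jumpOp_add_measure]
    have key : jumpOp μ (jumpIter (μ + ν) f (n + 1)) z
        ≤ jumpIter μ f (n + 2) z + (n + 1 : ℕ) * jumpOp ν (jumpIter (μ + ν) f (n + 1)) z := by
      refine (jumpOp_mono ih z).trans ?_
      rw [jumpOp_add_right _ h1, jumpOp_const_mul _ _ (measurable_jumpOp ν h2)]
      gcongr
      · exact le_rfl
      · rw [jumpOp_comm _ _ h2]
        refine jumpOp_mono (fun y => ?_) z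
        rw [jumpIter, jumpOp_add_measure]
        exact le_self_add
    calc _ ≤ (jumpIter μ f (n + 2) z + (n + 1 : ℕ) * jumpOp ν (jumpIter (μ + ν) f (n + 1)) z)
          + jumpOp ν (jumpIter (μ + ν) f (n + 1)) z := by gcongr
      _ = _ := by push_cast; ring

lemma jumpSeries_add_le (μ ν : Measure V) [SFinite μ] [SFinite ν] {f : V → ℝ≥0∞}
    (hf : Measurable f) (z : V) :
    jumpSeries (μ + ν) f z ≤ jumpSeries μ f z + jumpOp ν (jumpSeries (μ + ν) f) z := by
  rw [jumpOp_jumpSeries _ _ hf]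
  unfold jumpSeries
  rw [tsum_eq_zero_add' (f := fun n => ((n.factorial : ℝ≥0∞)⁻¹ * jumpIter (μ + ν) f n z))
    ENNReal.summable, tsum_eq_zero_add' (f := fun n => ((n.factorial : ℝ≥0∞)⁻¹ * jumpIter μ f n z))
    ENNReal.summable, add_assoc, ← ENNReal.tsum_add]
  gcongr with n
  · exact le_rfl
  · calc _ ≤ ((n + 1).factorial : ℝ≥0∞)⁻¹ * (jumpIter μ f (n + 1) z
          + (n + 1 : ℕ) * jumpOp ν (jumpIter (μ + ν) f n) z) := by
          gcongr; exact jumpIter_add_le μ ν hf n z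
      _ = _ := by
          rw [mul_add, ← mul_assoc]
          congr 2
          rw [Nat.factorial_succ, Nat.cast_mul, ENNReal.mul_inv (by simp) (by simp), mul_right_comm,
            ENNReal.inv_mul_cancel (by simp) (by simp), one_mul]

lemma jumpIter_tilt (ν : Measure V) (f : V → ℝ≥0∞) (hf : Measurable f) [SFinite ν]
    {e : V → ℝ≥0∞} (he : Measurable e) (hadd : ∀ x y, e (x + y) = e x * e y) (n : ℕ) (z : V) :
    e z * jumpIter ν f n z = jumpIter (ν.withDensity e) (fun x => e x * f x) n z := by
  induction n generalizing z with
  | zero => rfl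
  | succ n ih =>
    have hm := measurable_jumpIter ν hf n
    simp only [jumpIter, jumpOp, ← ih]
    rw [lintegral_withDensity_eq_lintegral_mul _ he (by fun_prop), ← lintegral_const_mul _ (by fun_prop)]
    congr 1; ext y
    have := hadd y (z - y)
    simp only [Pi.mul_apply]
    rw [← mul_assoc, ← this]; simp

lemma jumpSeries_tilt (ν : Measure V) (f : V → ℝ≥0∞) (hf : Measurable f) [SFinite ν]
    {e : V → ℝ≥0∞} (he : Measurable e) (hadd : ∀ x y, e (x + y) = e x * e y) (z : V) :
    e z * jumpSeries ν f z = jumpSeries (ν.withDensity e) (fun x => e x * f x) z := by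
  unfold jumpSeries
  rw [← ENNReal.tsum_mul_left]
  congr 1; ext n
  rw [← jumpIter_tilt ν f hf he hadd, mul_left_comm]

lemma tsum_inv_factorial_mul_pow {m : ℝ≥0∞} (hm : m ≠ ∞) :
    ∑' n : ℕ, (n.factorial : ℝ≥0∞)⁻¹ * m ^ n = ENNReal.ofReal (Real.exp m.toReal) := by
  lift m to ℝ≥0 using hm
  have h := NormedSpace.expSeries_div_hasSum_exp (m : ℝ)
  rw [ENNReal.coe_toReal, Real.exp_eq_exp_ℝ, ← h.tsum_eq,
    ENNReal.ofReal_tsum_of_nonneg (fun n => by positivity) h.summable]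
  congr 1; ext n
  rw [ENNReal.ofReal_div_of_pos (by positivity), ENNReal.ofReal_pow (by positivity)]
  simp [div_eq_mul_inv, mul_comm]

end JumpSeries

section Fourier

variable {V : Type*} [NormedAddCommGroup V] [InnerProductSpace ℝ V] [FiniteDimensional ℝ V]
  [MeasurableSpace V] [BorelSpace V]

lemma integrable_phase_mul {Γ : V → ℂ} (hΓ : Integrable Γ) {ν : Measure V} [IsFiniteMeasure ν]
    (n : ℕ) (z : V) :
    Integrable (fun ζ => Complex.exp (⟪z, ζ⟫ * Complex.I) * (Γ ζ * charFun ν (-ζ) ^ n)) := by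
  have h1 : Measurable (fun ζ : V => charFun ν (-ζ)) := by
    have := measurable_charFun (μ := ν); fun_prop
  have h2 : Integrable (fun ζ => Γ ζ * charFun ν (-ζ) ^ n) := by
    refine hΓ.mul_bdd (c := ν.real Set.univ ^ n) (h1.pow_const n).aestronglyMeasurable ?_
    filter_upwards with ζ
    rw [norm_pow]
    gcongr
    exact norm_charFun_le _
  refine h2.bdd_mul (c := 1) ?_ ?_
  · exact Continuous.aestronglyMeasurable (by fun_prop)
  · filter_upwards with ζ
    rw [Complex.norm_exp_ofReal_mul_I]

lemma jumpIter_fourier {Γ : V → ℂ} (hΓ : Integrable Γ) {g : V → ℝ} (hg0 : ∀ z, 0 ≤ g z)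
    (hg : ∀ z, (g z : ℂ) = ∫ ζ, Complex.exp (⟪z, ζ⟫ * Complex.I) * Γ ζ)
    (ν : Measure V) [IsFiniteMeasure ν] (n : ℕ) :
    ∃ h : V → ℝ, (∀ z, 0 ≤ h z) ∧
      (∀ z, (h z : ℂ) = ∫ ζ, Complex.exp (⟪z, ζ⟫ * Complex.I) * (Γ ζ * charFun ν (-ζ) ^ n)) ∧
      ∀ z, jumpIter ν (fun z => ENNReal.ofReal (g z)) n z = ENNReal.ofReal (h z) := by
  induction n with
  | zero => exact ⟨g, hg0, by simpa using hg, fun z => rfl⟩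
  | succ n ih =>
    obtain ⟨h, h0, hF, hj⟩ := ih
    have hint : ∀ z, Integrable (fun p : V × V => Complex.exp (⟪z - p.1, p.2⟫ * Complex.I) *
        (Γ p.2 * charFun ν (-p.2) ^ n)) (ν.prod volume) := by
      intro z
      have h2 := (integrable_phase_mul hΓ (ν := ν) n 0)
      simp only [inner_zero_left, Complex.ofReal_zero, zero_mul, Complex.exp_zero, one_mul] at h2
      refine (h2.comp_snd ν).bdd_mul (c := 1) ?_ ?_
      · exact Continuous.aestronglyMeasurable (by fun_prop)
      · filter_upwards with ζ
        rw [Complex.norm_exp_ofReal_mul_I]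
    have hint2 : ∀ z, Integrable (fun y => (h (z - y) : ℂ)) ν := by
      intro z
      have := (hint z).integral_prod_left
      simp only [← hF] at this
      exact this
    have hint3 : ∀ z, Integrable (fun y => h (z - y)) ν := fun z => by
      simpa using (hint2 z).re
    refine ⟨fun z => ∫ y, h (z - y) ∂ν, fun z => integral_nonneg fun y => h0 _, fun z => ?_,
      fun z => ?_⟩
    · rw [← integral_complex_ofReal]
      simp_rw [hF]
      rw [integral_integral_swap (hint z)]
      congr 1; ext ζ
      rw [pow_succ, charFun_apply]
      simp_rw [← mul_assoc]
      rw [← integral_const_mul]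
      congr 1; ext y
      have : Complex.exp (⟪z - y, ζ⟫ * Complex.I)
          = Complex.exp (⟪z, ζ⟫ * Complex.I) * Complex.exp (⟪y, -ζ⟫ * Complex.I) := by
        rw [← Complex.exp_add, inner_sub_left, inner_neg_right]
        congr 1
        push_cast
        ring
      rw [this]
      ring
    · rw [jumpIter, jumpOp, ofReal_integral_eq_lintegral_ofReal (hint3 z)
        (Filter.Eventually.of_forall fun y => h0 _)]
      simp_rw [hj]

lemma jumpSeries_fourier {Γ : V → ℂ} (hΓ : Integrable Γ) {g : V → ℝ} (hg0 : ∀ z, 0 ≤ g z)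
    (hg : ∀ z, (g z : ℂ) = ∫ ζ, Complex.exp (⟪z, ζ⟫ * Complex.I) * Γ ζ)
    (ν : Measure V) [IsFiniteMeasure ν] (z : V) :
    jumpSeries ν (fun z => ENNReal.ofReal (g z)) z = ENNReal.ofReal
      (∫ ζ, Complex.exp (⟪z, ζ⟫ * Complex.I) * (Γ ζ * Complex.exp (charFun ν (-ζ)))).re := by
  choose h h0 hF hj using jumpIter_fourier hΓ hg0 hg ν
  have hint := fun n => integrable_phase_mul hΓ (ν := ν) n z
  have hsum : HasSum (fun n : ℕ => ((n.factorial : ℝ)⁻¹ * h n z : ℝ))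
      (∫ ζ, Complex.exp (⟪z, ζ⟫ * Complex.I) * (Γ ζ * Complex.exp (charFun ν (-ζ)))).re := by
    have key := hasSum_integral_of_summable_integral_norm
      (F := fun (n : ℕ) ζ => ((n.factorial : ℂ)⁻¹ *
        (Complex.exp (⟪z, ζ⟫ * Complex.I) * (Γ ζ * charFun ν (-ζ) ^ n))))
      (μ := volume) (fun n => (hint n).const_mul _) ?_
    · have h2 := Complex.hasSum_re key
      convert h2 using 1
      · ext n
        rw [integral_const_mul, ← hF n z]
        rw [show ((n.factorial : ℂ)⁻¹ * (h n z : ℂ)) = (((n.factorial : ℝ)⁻¹ * h n z : ℝ) : ℂ) by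
          push_cast; rfl, Complex.ofReal_re]
      · congr 2
        ext ζ
        have := (NormedSpace.expSeries_div_hasSum_exp (charFun ν (-ζ))).tsum_eq
        rw [Complex.exp_eq_exp_ℂ, ← this, ← tsum_mul_left, ← tsum_mul_left]
        congr 1; ext n
        ring
    · have hs : Summable (fun n : ℕ => (ν.real Set.univ ^ n / n.factorial) * ∫ ζ, ‖Γ ζ‖) :=
        (Real.summable_pow_div_factorial _).mul_right _
      refine Summable.of_nonneg_of_le (fun n => by positivity) (fun n => ?_) hs
      rw [← integral_const_mul]
      refine integral_mono ((hint n).const_mul _).norm (hΓ.norm.const_mul _) fun ζ => ?_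
      simp only [norm_mul, norm_inv, norm_pow, Complex.norm_exp_ofReal_mul_I,
        Complex.norm_natCast, one_mul]
      rw [div_eq_inv_mul, mul_assoc, mul_comm ‖Γ ζ‖]
      gcongr
      exact norm_charFun_le _
  unfold jumpSeries
  rw [← hsum.tsum_eq, ENNReal.ofReal_tsum_of_nonneg
    (fun n => mul_nonneg (by positivity) (h0 _ _)) hsum.summable]
  congr 1; ext n
  rw [hj, ENNReal.ofReal_mul (by positivity), ENNReal.ofReal_inv_of_pos (by positivity)]
  simp

end Fourier

section Gauss

variable {V : Type*} [NormedAddCommGroup V] [InnerProductSpace ℝ V] [FiniteDimensional ℝ V]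
  [MeasurableSpace V] [BorelSpace V]

/-- The Fourier transform of `ζ ↦ exp (-τ ‖ζ‖ ^ 2)`. -/
noncomputable def gaussProf (τ : ℝ) (z : V) : ℝ :=
  (π / τ) ^ (Module.finrank ℝ V / 2 : ℝ) * Real.exp (-(‖z‖ ^ 2 / (4 * τ)))

lemma continuous_gaussProf (τ : ℝ) : Continuous (gaussProf τ : V → ℝ) := by
  unfold gaussProf; fun_prop

lemma gaussProf_nonneg {τ : ℝ} (hτ : 0 < τ) (z : V) : 0 ≤ gaussProf τ z := by
  unfold gaussProf; positivity

lemma gaussProf_eq_integral {τ : ℝ} (hτ : 0 < τ) (z : V) :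
    (gaussProf τ z : ℂ) = ∫ ζ : V, Complex.exp (⟪z, ζ⟫ * Complex.I) *
      Complex.exp (-(τ : ℂ) * ‖ζ‖ ^ 2) := by
  have h := GaussianFourier.integral_cexp_neg_mul_sq_norm_add (b := (τ : ℂ)) (by simpa using hτ)
    Complex.I z
  simp_rw [← Complex.exp_add]
  rw [show (fun ζ : V => Complex.exp (⟪z, ζ⟫ * Complex.I + -(τ : ℂ) * ‖ζ‖ ^ 2))
    = fun ζ : V => Complex.exp (-(τ : ℂ) * ‖ζ‖ ^ 2 + Complex.I * ⟪z, ζ⟫) by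
      ext ζ; congr 1; ring, h]
  unfold gaussProf
  push_cast
  rw [← Complex.ofReal_div, Complex.ofReal_cpow (by positivity)]
  push_cast
  congr 2
  rw [Complex.I_sq]
  ring

lemma integrable_cexp_gauss {τ : ℝ} (hτ : 0 < τ) :
    Integrable (fun ζ : V => Complex.exp (-(τ : ℂ) * ‖ζ‖ ^ 2)) := by
  simpa using GaussianFourier.integrable_cexp_neg_mul_sq_norm_add (b := (τ : ℂ))
    (by simpa using hτ) 0 (0 : V)

lemma exp_mul_gaussProf {τ : ℝ} (hτ : 0 < τ) (θ z : V) :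
    Real.exp ⟪θ, z⟫ * gaussProf τ z
      = Real.exp (τ * ‖θ‖ ^ 2) * gaussProf τ (z - (2 * τ) • θ) := by
  unfold gaussProf
  rw [mul_left_comm, mul_left_comm (Real.exp (τ * ‖θ‖ ^ 2)), ← Real.exp_add, ← Real.exp_add,
    norm_sub_sq_real, inner_smul_right, norm_smul, mul_pow, Real.norm_eq_abs, sq_abs,
    real_inner_comm]
  congr 2
  field_simp
  ring

lemma exp_mul_gaussProf_eq_integral {τ : ℝ} (hτ : 0 < τ) (θ z : V) :
    ((Real.exp ⟪θ, z⟫ * gaussProf τ z : ℝ) : ℂ) = ∫ ζ : V, Complex.exp (⟪z, ζ⟫ * Complex.I) *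
      (Complex.exp ((-(2 * τ * ⟪θ, ζ⟫) : ℝ) * Complex.I) *
        (Real.exp (τ * ‖θ‖ ^ 2) * Complex.exp (-(τ : ℂ) * ‖ζ‖ ^ 2))) := by
  rw [exp_mul_gaussProf hτ, Complex.ofReal_mul, gaussProf_eq_integral hτ, ← integral_const_mul]
  congr 1; ext ζ
  rw [inner_sub_left, inner_smul_left, ← mul_assoc, ← mul_assoc (Complex.exp _), ← Complex.exp_add,
    ← mul_assoc, mul_comm (Real.exp _ : ℂ)]
  congr 3
  simp only [conj_trivial]
  push_cast
  ring

/-- The symbol of the compound Poisson process with jump measure `ν`. -/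
noncomputable def levySymbol (ν : Measure V) (ζ : V) : ℝ := ∫ y, (1 - Real.cos ⟪ζ, y⟫) ∂ν

lemma integrable_cos_inner (ν : Measure V) [IsFiniteMeasure ν] (ζ : V) :
    Integrable (fun y => Real.cos ⟪ζ, y⟫) ν :=
  Integrable.of_bound (C := 1) (Continuous.aestronglyMeasurable (by fun_prop))
    (Filter.Eventually.of_forall fun y => by simpa using Real.abs_cos_le_one _)

lemma levySymbol_eq (ν : Measure V) [IsFiniteMeasure ν] (ζ : V) :
    levySymbol ν ζ = ν.real Set.univ - ∫ y, Real.cos ⟪ζ, y⟫ ∂ν := by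
  unfold levySymbol
  rw [integral_sub (integrable_const _) (integrable_cos_inner ν ζ)]
  simp

lemma levySymbol_nonneg (ν : Measure V) (ζ : V) : 0 ≤ levySymbol ν ζ :=
  integral_nonneg fun y => by simpa using Real.cos_le_one _

lemma measurable_levySymbol (ν : Measure V) [SFinite ν] : Measurable (levySymbol ν) := by
  unfold levySymbol
  have : StronglyMeasurable (fun p : V × V => 1 - Real.cos ⟪p.1, p.2⟫) :=
    Continuous.stronglyMeasurable (by fun_prop)
  exact this.integral_prod_right.measurable

lemma integrable_exp_neg_symbol (ν : Measure V) [SFinite ν] {τ : ℝ} (hτ : 0 < τ) :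
    Integrable (fun ζ : V => Real.exp (-(τ * ‖ζ‖ ^ 2 + levySymbol ν ζ))) := by
  refine (integrable_cexp_gauss (V := V) hτ).norm.mono' ?_ ?_
  · have := measurable_levySymbol ν
    exact (by fun_prop : Measurable _).aestronglyMeasurable
  · filter_upwards with ζ
    have := levySymbol_nonneg ν ζ
    rw [Complex.norm_exp, Real.norm_eq_abs, Real.abs_exp]
    norm_cast
    gcongr
    linarith

/-- The density of a compound Poisson process with jump measure `ν`, regularised by a Gaussian. -/
noncomputable def heatApprox (ν : Measure V) (τ : ℝ) (z : V) : ℝ≥0∞ :=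
  ENNReal.ofReal (Real.exp (-ν.real Set.univ)) *
    jumpSeries ν (fun z => ENNReal.ofReal (gaussProf τ z)) z

lemma measurable_ofReal_gaussProf (τ : ℝ) :
    Measurable (fun z : V => ENNReal.ofReal (gaussProf τ z)) :=
  (continuous_gaussProf τ).measurable.ennreal_ofReal

lemma measurable_heatApprox (ν : Measure V) [SFinite ν] (τ : ℝ) : Measurable (heatApprox ν τ) :=
  (measurable_jumpSeries ν (measurable_ofReal_gaussProf τ)).const_mul _

lemma charFun_im_eq_zero {ν : Measure V} [IsFiniteMeasure ν] (hν : ν.map (fun y => -y) = ν) (ζ : V) :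
    (charFun ν ζ).im = 0 := by
  have h : charFun ν ζ = charFun ν (-ζ) := by
    conv_lhs => rw [← hν]
    rw [charFun_apply, integral_map (by fun_prop) (Continuous.aestronglyMeasurable (by fun_prop)),
      charFun_apply]
    simp
  rw [charFun_neg] at h
  have := congrArg Complex.im h
  rw [Complex.conj_im] at this
  linarith

lemma charFun_re (ν : Measure V) [IsFiniteMeasure ν] (ζ : V) :
    (charFun ν ζ).re = ∫ y, Real.cos ⟪ζ, y⟫ ∂ν := by
  rw [charFun_apply]
  have : Integrable (fun y => Complex.exp (⟪y, ζ⟫ * Complex.I)) ν :=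
    Integrable.of_bound (C := 1) (Continuous.aestronglyMeasurable (by fun_prop))
      (Filter.Eventually.of_forall fun y => by rw [Complex.norm_exp_ofReal_mul_I])
  rw [← RCLike.re_eq_complex_re, ← integral_re this]
  congr 1; ext y
  rw [RCLike.re_eq_complex_re, Complex.exp_ofReal_mul_I_re, real_inner_comm]

lemma heatApprox_eq {ν : Measure V} [IsFiniteMeasure ν] (hν : ν.map (fun y => -y) = ν)
    {τ : ℝ} (hτ : 0 < τ) (z : V) :
    heatApprox ν τ z = ENNReal.ofReal
      (∫ ζ : V, Real.cos ⟪z, ζ⟫ * Real.exp (-(τ * ‖ζ‖ ^ 2 + levySymbol ν ζ))) := by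
  have hch : ∀ ζ : V, charFun ν (-ζ) = ((ν.real Set.univ - levySymbol ν ζ : ℝ) : ℂ) := by
    intro ζ
    apply Complex.ext
    · rw [charFun_re, Complex.ofReal_re, levySymbol_eq]
      simp
    · rw [charFun_im_eq_zero hν, Complex.ofReal_im]
  unfold heatApprox
  rw [jumpSeries_fourier (integrable_cexp_gauss hτ) (gaussProf_nonneg hτ)
    (gaussProf_eq_integral hτ), ← ENNReal.ofReal_mul (by positivity)]
  congr 1
  have hint := integrable_exp_neg_symbol ν hτ
  have hint2 : Integrable (fun ζ : V => Complex.exp (⟪z, ζ⟫ * Complex.I) *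
      (Real.exp (-(τ * ‖ζ‖ ^ 2 + levySymbol ν ζ)) : ℂ)) := by
    refine hint.ofReal.bdd_mul (c := 1) ?_ ?_
    · exact Continuous.aestronglyMeasurable (by fun_prop)
    · filter_upwards with ζ
      rw [Complex.norm_exp_ofReal_mul_I]
  have heq : (fun ζ : V => Complex.exp (⟪z, ζ⟫ * Complex.I) * (Complex.exp (-(τ : ℂ) * ‖ζ‖ ^ 2) *
      Complex.exp (charFun ν (-ζ)))) = fun ζ : V => (Real.exp (ν.real Set.univ) : ℂ) *
        (Complex.exp (⟪z, ζ⟫ * Complex.I) *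
          (Real.exp (-(τ * ‖ζ‖ ^ 2 + levySymbol ν ζ)) : ℂ)) := by
    ext ζ
    rw [hch]
    push_cast
    simp only [← Complex.exp_add]
    congr 1
    ring
  rw [heq, integral_const_mul, Complex.re_ofReal_mul, ← mul_assoc, ← Real.exp_add]
  simp only [neg_add_cancel, Real.exp_zero, one_mul]
  rw [← RCLike.re_eq_complex_re, ← integral_re hint2]
  congr 1; ext ζ
  rw [RCLike.re_eq_complex_re, mul_comm, Complex.re_ofReal_mul, Complex.exp_ofReal_mul_I_re,
    mul_comm]

lemma exp_inner_mul_heatApprox_le {ν : Measure V} [IsFiniteMeasure ν]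
    (hν : ν.map (fun y => -y) = ν) {τ : ℝ} (hτ : 0 < τ) (θ z : V)
    (hθ : Integrable (fun y => Real.exp ⟪θ, y⟫) ν) :
    ENNReal.ofReal (Real.exp ⟪θ, z⟫) * heatApprox ν τ z ≤ ENNReal.ofReal
      (Real.exp (τ * ‖θ‖ ^ 2 + ∫ y, (Real.cosh ⟪θ, y⟫ - 1) ∂ν) *
        ∫ ζ : V, Real.exp (-(τ * ‖ζ‖ ^ 2 + levySymbol ν ζ))) := by
  have hneg : ∀ F : V → ℝ, ∫ y, F (-y) ∂ν = ∫ y, F y ∂ν := fun F => by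
    conv_rhs => rw [← hν]
    exact ((MeasurableEquiv.neg V).measurableEmbedding.integral_map F).symm
  have hθ' : Integrable (fun y => Real.exp (-⟪θ, y⟫)) ν := by
    have h := ((MeasurableEquiv.neg V).measurableEmbedding.integrable_map_iff (μ := ν)
      (g := fun y => Real.exp ⟪θ, y⟫)).mp (by
        change Integrable _ (ν.map (fun y => -y))
        rwa [hν])
    simpa [Function.comp_def] using h
  have hcosh : Integrable (fun y => Real.cosh ⟪θ, y⟫) ν := by
    simp_rw [Real.cosh_eq]
    exact (hθ.add hθ').div_const 2
  set e : V → ℝ≥0∞ := fun y => ENNReal.ofReal (Real.exp ⟪θ, y⟫) with he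
  have hem : Measurable e := by fun_prop
  have hadd : ∀ x y, e (x + y) = e x * e y := fun x y => by
    simp only [he]
    rw [inner_add_right, Real.exp_add, ENNReal.ofReal_mul (by positivity)]
  have hfin : IsFiniteMeasure (ν.withDensity e) :=
    isFiniteMeasure_withDensity_ofReal hθ.2
  set Γ : V → ℂ := fun ζ => Complex.exp ((-(2 * τ * ⟪θ, ζ⟫) : ℝ) * Complex.I) *
        (Real.exp (τ * ‖θ‖ ^ 2) * Complex.exp (-(τ : ℂ) * ‖ζ‖ ^ 2)) with hΓ
  have hΓi : Integrable Γ := by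
    refine ((integrable_cexp_gauss hτ).const_mul _).bdd_mul (c := 1) ?_ ?_
    · exact Continuous.aestronglyMeasurable (by fun_prop)
    · filter_upwards with ζ
      rw [Complex.norm_exp_ofReal_mul_I]
  have hre : ∀ ζ, (charFun (ν.withDensity e) (-ζ)).re ≤
      ν.real Set.univ + ∫ y, (Real.cosh ⟪θ, y⟫ - 1) ∂ν - levySymbol ν ζ := by
    intro ζ
    have hb : ∀ (F : V → ℝ), Integrable F ν → Integrable (fun y => Real.cos ⟪ζ, y⟫ * F y) ν := by
      intro F hF
      refine hF.bdd_mul (c := 1) (Continuous.aestronglyMeasurable (by fun_prop)) ?_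
      filter_upwards with y
      simpa using Real.abs_cos_le_one _
    rw [charFun_re, integral_withDensity_eq_integral_toReal_smul hem (by simp [he])]
    have h1 : ∀ y, (e y).toReal • Real.cos ⟪-ζ, y⟫ = Real.cos ⟪ζ, y⟫ * Real.exp ⟪θ, y⟫ := by
      intro y
      rw [he, ENNReal.toReal_ofReal (by positivity), inner_neg_left, Real.cos_neg, smul_eq_mul,
        mul_comm]
    simp_rw [h1]
    have h2 : ∫ y, Real.cos ⟪ζ, y⟫ * Real.exp ⟪θ, y⟫ ∂ν
        = ∫ y, Real.cos ⟪ζ, y⟫ * Real.cosh ⟪θ, y⟫ ∂ν := by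
      have h3 := hneg (fun y => Real.cos ⟪ζ, y⟫ * Real.exp ⟪θ, y⟫)
      simp only [inner_neg_right, Real.cos_neg] at h3
      simp_rw [Real.cosh_eq, mul_div_assoc', mul_add]
      rw [integral_div, integral_add (hb _ hθ) (hb _ hθ'), h3]
      ring
    rw [h2]
    calc _ ≤ ∫ y, (1 + (Real.cosh ⟪θ, y⟫ - 1) - (1 - Real.cos ⟪ζ, y⟫)) ∂ν := by
          refine integral_mono (hb _ hcosh) (((integrable_const _).add (hcosh.sub
            (integrable_const _))).sub ((integrable_const _).sub (integrable_cos_inner ν ζ)))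
            fun y => ?_
          have := Real.cos_le_one ⟪ζ, y⟫
          have := Real.one_le_cosh ⟪θ, y⟫
          simp only
          nlinarith
      _ = _ := by
          have i1 : Integrable (fun y => Real.cosh ⟪θ, y⟫ - 1) ν := hcosh.sub (integrable_const _)
          have i2 : Integrable (fun y => 1 + (Real.cosh ⟪θ, y⟫ - 1)) ν := (integrable_const _).add i1
          have i3 : Integrable (fun y => 1 - Real.cos ⟪ζ, y⟫) ν :=
            (integrable_const _).sub (integrable_cos_inner ν ζ)
          rw [integral_sub i2 i3, integral_add (integrable_const _) i1]
          simp [levySymbol]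
  have key : e z * jumpSeries ν (fun z => ENNReal.ofReal (gaussProf τ z)) z = ENNReal.ofReal
      (∫ ζ, Complex.exp (⟪z, ζ⟫ * Complex.I) *
        (Γ ζ * Complex.exp (charFun (ν.withDensity e) (-ζ)))).re := by
    rw [jumpSeries_tilt ν _ (measurable_ofReal_gaussProf τ) hem hadd]
    have := jumpSeries_fourier hΓi (g := fun z => Real.exp ⟪θ, z⟫ * gaussProf τ z)
      (fun z => mul_nonneg (by positivity) (gaussProf_nonneg hτ z))
      (exp_mul_gaussProf_eq_integral hτ θ) (ν.withDensity e) z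
    rw [← this]
    congr 1; ext y
    rw [ENNReal.ofReal_mul (by positivity)]
  unfold heatApprox
  rw [mul_left_comm, key, ← ENNReal.ofReal_mul (by positivity)]
  apply ENNReal.ofReal_le_ofReal
  have hbound : (∫ ζ, Complex.exp (⟪z, ζ⟫ * Complex.I) *
        (Γ ζ * Complex.exp (charFun (ν.withDensity e) (-ζ)))).re ≤
      ∫ ζ, Real.exp (ν.real Set.univ) * (Real.exp (τ * ‖θ‖ ^ 2 + ∫ y, (Real.cosh ⟪θ, y⟫ - 1) ∂ν) *
        Real.exp (-(τ * ‖ζ‖ ^ 2 + levySymbol ν ζ))) := by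
    refine (Complex.re_le_norm _).trans (norm_integral_le_of_norm_le
      (((integrable_exp_neg_symbol ν hτ).const_mul _).const_mul _) ?_)
    filter_upwards with ζ
    rw [norm_mul, norm_mul, norm_mul, norm_mul, Complex.norm_exp_ofReal_mul_I,
      Complex.norm_exp_ofReal_mul_I, Complex.norm_exp, Complex.norm_exp, one_mul, one_mul,
      Complex.norm_real, Real.norm_eq_abs, Real.abs_exp, ← Real.exp_add, ← Real.exp_add,
      ← Real.exp_add, ← Real.exp_add]
    apply Real.exp_le_exp.mpr
    have := hre ζ
    have h5 : (-(τ : ℂ) * ‖ζ‖ ^ 2).re = -(τ * ‖ζ‖ ^ 2) := by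
      norm_cast
      simp
    rw [h5]
    linarith
  rw [integral_const_mul, integral_const_mul] at hbound
  refine (mul_le_mul_of_nonneg_left hbound (Real.exp_nonneg _)).trans_eq ?_
  rw [← mul_assoc, ← Real.exp_add]
  simp

end Gauss

section Decay

lemma Real.cosh_sub_one_le (u : ℝ) : Real.cosh u - 1 ≤ u ^ 2 * Real.exp |u| := by
  have hs : ∀ x : ℝ, 0 ≤ x → Real.sinh x ≤ x * Real.exp x := by
    intro x _
    have h1 := Real.add_one_le_exp (-(2 * x))
    have h2 : Real.exp (-x) = Real.exp x * Real.exp (-(2 * x)) := by rw [← Real.exp_add]; ring_nf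
    rw [Real.sinh_eq, h2]
    nlinarith [Real.exp_pos x]
  have h3 := hs (|u| / 2) (by positivity)
  have h4 : 0 ≤ Real.sinh (|u| / 2) := Real.sinh_nonneg_iff.mpr (by positivity)
  have h5 : Real.cosh u = Real.cosh (2 * (|u| / 2)) := by
    rw [mul_div_cancel₀ _ (two_ne_zero), Real.cosh_abs]
  have h6 : Real.exp |u| = Real.exp (|u| / 2) * Real.exp (|u| / 2) := by
    rw [← Real.exp_add]; ring_nf
  have h7 : Real.sinh (|u| / 2) * Real.sinh (|u| / 2)
      ≤ (|u| / 2 * Real.exp (|u| / 2)) * (|u| / 2 * Real.exp (|u| / 2)) := by gcongr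
  rw [h5, Real.cosh_two_mul, Real.cosh_sq, h6, ← sq_abs u]
  have h8 : 0 ≤ |u| ^ 2 * (Real.exp (|u| / 2) * Real.exp (|u| / 2)) := by positivity
  nlinarith

variable {V : Type*} [NormedAddCommGroup V] [InnerProductSpace ℝ V] [FiniteDimensional ℝ V]
  [MeasurableSpace V] [BorelSpace V]

lemma integrable_exp_neg_norm_rpow {c α : ℝ} (hc : 0 < c) (hα : 0 < α) :
    Integrable (fun ζ : V => Real.exp (-(c * ‖ζ‖ ^ α))) := by
  set r : ℝ := Module.finrank ℝ V + 1
  obtain ⟨n, hn⟩ := exists_nat_ge (r / α)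
  have hn' : r ≤ α * n := by rwa [div_le_iff₀' hα] at hn
  have hr : 0 < r := by positivity
  refine Integrable.mono' ((integrable_one_add_norm (E := V) (r := r) (by simp [r])).const_mul
    (2 ^ r * (1 + n.factorial / c ^ n))) (Continuous.aestronglyMeasurable ?_) ?_
  · have : Continuous fun ζ : V => ‖ζ‖ ^ α := continuous_norm.rpow_const fun _ => Or.inr hα.le
    fun_prop
  filter_upwards with ζ
  rw [Real.norm_eq_abs, Real.abs_exp, Real.exp_neg, Real.rpow_neg (by positivity),
    ← div_eq_mul_inv, inv_eq_one_div, div_le_div_iff₀ (by positivity) (by positivity), one_mul]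
  have h1 : (c * ‖ζ‖ ^ α) ^ n / n.factorial ≤ Real.exp (c * ‖ζ‖ ^ α) :=
    Real.pow_div_factorial_le_exp _ (by positivity) n
  have h2 : ‖ζ‖ ^ (α * n) ≤ n.factorial / c ^ n * Real.exp (c * ‖ζ‖ ^ α) := by
    rw [mul_pow, ← Real.rpow_mul_natCast (norm_nonneg _)] at h1
    calc ‖ζ‖ ^ (α * n) = n.factorial / c ^ n * (c ^ n * ‖ζ‖ ^ (α * n) / n.factorial) := by
          field_simp
      _ ≤ _ := by gcongr
  have h3 : 1 ≤ Real.exp (c * ‖ζ‖ ^ α) := Real.one_le_exp (by positivity)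
  have h4 : (1 + ‖ζ‖) ^ r ≤ 2 ^ r * (1 + ‖ζ‖ ^ (α * n)) := by
    rcases le_total ‖ζ‖ 1 with h | h
    · calc (1 + ‖ζ‖) ^ r ≤ 2 ^ r := by gcongr; linarith
        _ = 2 ^ r * (1 + 0) := by ring
        _ ≤ _ := by gcongr; positivity
    · calc (1 + ‖ζ‖) ^ r ≤ (2 * ‖ζ‖) ^ r := by gcongr; linarith
        _ = 2 ^ r * ‖ζ‖ ^ r := Real.mul_rpow (by norm_num) (by positivity)
        _ ≤ 2 ^ r * ‖ζ‖ ^ (α * n) := by gcongr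
        _ ≤ _ := by gcongr; linarith
  calc _ ≤ _ := h4
    _ ≤ 2 ^ r * (Real.exp (c * ‖ζ‖ ^ α) + n.factorial / c ^ n * Real.exp (c * ‖ζ‖ ^ α)) := by
      gcongr
    _ = _ := by ring

lemma heatApprox_add_le {μ ν : Measure V} [IsFiniteMeasure μ] [IsFiniteMeasure ν] {τ : ℝ} (z : V) :
    heatApprox (μ + ν) τ z ≤ heatApprox μ τ z + jumpOp ν (heatApprox (μ + ν) τ) z := by
  have hm := measurable_ofReal_gaussProf (V := V) τ
  have h := jumpSeries_add_le μ ν hm z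
  unfold heatApprox
  rw [jumpOp_const_mul _ _ (measurable_jumpSeries _ hm)]
  refine (mul_le_mul_right h _).trans ?_
  rw [mul_add]
  gcongr
  rw [measureReal_add_apply]
  exact le_add_of_nonneg_right measureReal_nonneg

lemma heatApprox_le_of_symbol {ν : Measure V} [IsFiniteMeasure ν]
    (hν : ν.map (fun y => -y) = ν) {τ : ℝ} (hτ : 0 < τ) {c α K : ℝ} (hc : 0 < c) (hα : 0 < α)
    (hlow : ∀ ζ : V, c * ‖ζ‖ ^ α - K ≤ τ * ‖ζ‖ ^ 2 + levySymbol ν ζ) (θ z : V)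
    (hθ : Integrable (fun y => Real.exp ⟪θ, y⟫) ν) :
    ENNReal.ofReal (Real.exp ⟪θ, z⟫) * heatApprox ν τ z ≤ ENNReal.ofReal
      (Real.exp (τ * ‖θ‖ ^ 2 + ∫ y, (Real.cosh ⟪θ, y⟫ - 1) ∂ν) *
        (Real.exp K * ∫ ζ : V, Real.exp (-(c * ‖ζ‖ ^ α)))) := by
  refine (exp_inner_mul_heatApprox_le hν hτ θ z hθ).trans ?_
  gcongr
  rw [← integral_const_mul]
  refine integral_mono (integrable_exp_neg_symbol ν hτ)
    ((integrable_exp_neg_norm_rpow hc hα).const_mul _) fun ζ => ?_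
  simp only
  rw [← Real.exp_add]
  gcongr
  linarith [hlow ζ]

lemma heatApprox_le_const {ν : Measure V} [IsFiniteMeasure ν]
    (hν : ν.map (fun y => -y) = ν) {τ : ℝ} (hτ : 0 < τ) {c α K : ℝ} (hc : 0 < c) (hα : 0 < α)
    (hlow : ∀ ζ : V, c * ‖ζ‖ ^ α - K ≤ τ * ‖ζ‖ ^ 2 + levySymbol ν ζ) (z : V) :
    heatApprox ν τ z ≤ ENNReal.ofReal (Real.exp K * ∫ ζ : V, Real.exp (-(c * ‖ζ‖ ^ α))) := by
  simpa using heatApprox_le_of_symbol hν hτ hc hα hlow 0 z (by simp)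

lemma heatApprox_truncated_le {ν : Measure V} [IsFiniteMeasure ν]
    (hν : ν.map (fun y => -y) = ν) {τ : ℝ} (hτ : 0 < τ) (hτ1 : τ ≤ 1) {c α K k M R : ℝ}
    (hc : 0 < c) (hα : 0 < α) (hK : 0 ≤ K) (hk : 0 ≤ k)
    (hlow : ∀ ζ : V, c * ‖ζ‖ ^ α - K ≤ τ * ‖ζ‖ ^ 2 + levySymbol ν ζ)
    (hsupp : ∀ᵐ y ∂ν, ‖y‖ ≤ M) (hR : 1 ≤ R) (hM : k * M ≤ α / 2 * R)
    (hmom : ∫ y, ‖y‖ ^ 2 ∂ν ≤ K * R ^ (2 - α)) {z : V} (hz : ‖z‖ = R) :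
    heatApprox ν τ z ≤ ENNReal.ofReal (Real.exp (k ^ 2 + k ^ 2 * K * (4 / α) ^ 2) *
        (Real.exp K * ∫ ζ : V, Real.exp (-(c * ‖ζ‖ ^ α))) * R ^ (-k)) := by
  have hR0 : 0 < R := by linarith
  have hlog : 0 ≤ Real.log R := Real.log_nonneg hR
  set θ : V := (k * Real.log R / R ^ 2) • z with hθdef
  have hθz : Real.exp ⟪θ, z⟫ = R ^ k := by
    rw [hθdef, inner_smul_left, real_inner_self_eq_norm_sq, hz, Real.rpow_def_of_pos hR0]
    congr 1
    simp only [conj_trivial]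
    field_simp
  have hθn : ‖θ‖ = k * Real.log R / R := by
    rw [hθdef, norm_smul, hz, Real.norm_of_nonneg (by positivity)]
    field_simp
  have hθk : ‖θ‖ ≤ k := by
    rw [hθn, div_le_iff₀ hR0]
    gcongr
    linarith [Real.log_le_sub_one_of_pos hR0]
  have habs : ∀ᵐ y ∂ν, |⟪θ, y⟫| ≤ α / 2 * Real.log R := by
    filter_upwards [hsupp] with y hy
    calc |⟪θ, y⟫| ≤ ‖θ‖ * ‖y‖ := abs_real_inner_le_norm _ _
      _ ≤ ‖θ‖ * M := by gcongr
      _ = (k * M) * (Real.log R / R) := by rw [hθn]; ring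
      _ ≤ (α / 2 * R) * (Real.log R / R) := by gcongr
      _ = _ := by field_simp
  have hθi : Integrable (fun y => Real.exp ⟪θ, y⟫) ν := by
    refine Integrable.of_bound (C := Real.exp (α / 2 * Real.log R))
      (Continuous.aestronglyMeasurable (by fun_prop)) ?_
    filter_upwards [habs] with y hy
    rw [Real.norm_eq_abs, Real.abs_exp]
    gcongr
    exact (le_abs_self _).trans hy
  have hsq : Integrable (fun y => ‖y‖ ^ 2) ν := by
    refine Integrable.of_bound (C := M ^ 2) (Continuous.aestronglyMeasurable (by fun_prop)) ?_
    filter_upwards [hsupp] with y hy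
    rw [norm_pow, norm_norm]
    gcongr
  have hcosh : ∫ y, (Real.cosh ⟪θ, y⟫ - 1) ∂ν ≤ k ^ 2 * K * (4 / α) ^ 2 := by
    have h1 : ∫ y, (Real.cosh ⟪θ, y⟫ - 1) ∂ν ≤ ∫ y, (‖θ‖ ^ 2 * R ^ (α / 2)) * ‖y‖ ^ 2 ∂ν := by
      refine integral_mono_of_nonneg ?_ (hsq.const_mul _) ?_
      · exact Filter.Eventually.of_forall fun y => by simp [Real.one_le_cosh]
      · filter_upwards [habs] with y hy
        have h2 : ⟪θ, y⟫ ^ 2 ≤ (‖θ‖ * ‖y‖) ^ 2 := by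
          rw [← sq_abs]
          gcongr
          exact abs_real_inner_le_norm _ _
        calc _ ≤ ⟪θ, y⟫ ^ 2 * Real.exp |⟪θ, y⟫| := Real.cosh_sub_one_le _
          _ ≤ (‖θ‖ * ‖y‖) ^ 2 * Real.exp (α / 2 * Real.log R) := by gcongr
          _ = _ := by rw [Real.rpow_def_of_pos hR0, mul_comm (α / 2)]; ring
    rw [integral_const_mul] at h1
    have h3 : Real.log R ≤ R ^ (α / 4) * (4 / α) := by
      have := Real.log_le_rpow_div hR0.le (show 0 < α / 4 by positivity)
      calc _ ≤ _ := this
        _ = _ := by field_simp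
    calc _ ≤ _ := h1
      _ ≤ (‖θ‖ ^ 2 * R ^ (α / 2)) * (K * R ^ (2 - α)) := by gcongr
      _ = k ^ 2 * K * (Real.log R) ^ 2 * R ^ (-(α / 2)) := by
          have h4 : R ^ (-(α / 2)) = R ^ (α / 2) * R ^ (2 - α) * R ^ (-2 : ℝ) := by
            rw [← Real.rpow_add hR0, ← Real.rpow_add hR0]; ring_nf
          rw [h4, hθn, Real.rpow_neg hR0.le, Real.rpow_two]
          field_simp
      _ ≤ k ^ 2 * K * (R ^ (α / 4) * (4 / α)) ^ 2 * R ^ (-(α / 2)) := by gcongr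
      _ = k ^ 2 * K * (4 / α) ^ 2 * (R ^ (α / 4) * R ^ (α / 4) * R ^ (-(α / 2))) := by ring
      _ = _ := by
          rw [← Real.rpow_add hR0, ← Real.rpow_add hR0]
          ring_nf
          simp
  have key := heatApprox_le_of_symbol hν hτ hc hα hlow θ z hθi
  rw [hθz] at key
  have hI : 0 ≤ ∫ ζ : V, Real.exp (-(c * ‖ζ‖ ^ α)) := integral_nonneg fun _ => by positivity
  have hpos : ENNReal.ofReal (R ^ k) ≠ 0 := by
    simpa using Real.rpow_pos_of_pos hR0 k
  rw [mul_comm, ← ENNReal.le_div_iff_mul_le (Or.inl hpos) (Or.inl ENNReal.ofReal_ne_top),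
    ← ENNReal.ofReal_div_of_pos (Real.rpow_pos_of_pos hR0 k)] at key
  refine key.trans (ENNReal.ofReal_le_ofReal ?_)
  rw [Real.rpow_neg hR0.le, div_eq_mul_inv]
  gcongr
  calc τ * ‖θ‖ ^ 2 ≤ 1 * k ^ 2 := by gcongr
    _ = _ := one_mul _

end Decay

section Mass

variable {V : Type*} [NormedAddCommGroup V] [InnerProductSpace ℝ V] [FiniteDimensional ℝ V]
  [MeasurableSpace V] [BorelSpace V]

lemma jumpIter_const_mul (ν : Measure V) [SFinite ν] (c : ℝ≥0∞) {f : V → ℝ≥0∞} (hf : Measurable f)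
    (n : ℕ) (z : V) : jumpIter ν (fun x => c * f x) n z = c * jumpIter ν f n z := by
  induction n generalizing z with
  | zero => rfl
  | succ n ih =>
    simp only [jumpIter]
    rw [← jumpOp_const_mul _ _ (measurable_jumpIter ν hf n)]
    simp only [jumpOp, ih]

lemma jumpSeries_const_mul (ν : Measure V) [SFinite ν] (c : ℝ≥0∞) {f : V → ℝ≥0∞}
    (hf : Measurable f) (z : V) : jumpSeries ν (fun x => c * f x) z = c * jumpSeries ν f z := by
  unfold jumpSeries
  rw [← ENNReal.tsum_mul_left]
  congr 1; ext n
  rw [jumpIter_const_mul ν c hf, mul_left_comm]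

lemma lintegral_jumpIter (ν : Measure V) [SFinite ν] {f : V → ℝ≥0∞} (hf : Measurable f) (n : ℕ) :
    ∫⁻ z, jumpIter ν f n z = ν Set.univ ^ n * ∫⁻ z, f z := by
  induction n with
  | zero => simp [jumpIter]
  | succ n ih =>
    have hm := measurable_jumpIter ν hf n
    simp only [jumpIter, jumpOp]
    rw [lintegral_lintegral_swap]
    · simp_rw [lintegral_sub_right_eq_self (jumpIter ν f n), ih]
      rw [lintegral_const, pow_succ]
      ring
    · have : Measurable (fun p : V × V => jumpIter ν f n (p.1 - p.2)) := by fun_prop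
      exact this.aemeasurable

lemma lintegral_ofReal_exp_neg_mul_sq_norm {b : ℝ} (hb : 0 < b) :
    ∫⁻ v : V, ENNReal.ofReal (Real.exp (-b * ‖v‖ ^ 2))
      = ENNReal.ofReal ((π / b) ^ (Module.finrank ℝ V / 2 : ℝ)) := by
  rw [← GaussianFourier.integral_rexp_neg_mul_sq_norm hb, ofReal_integral_eq_lintegral_ofReal]
  · have h := (integrable_cexp_gauss (V := V) hb).norm
    refine h.congr (Filter.Eventually.of_forall fun v => ?_)
    simp only [Complex.norm_exp]
    norm_cast
  · exact Filter.Eventually.of_forall fun v => by positivity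

lemma lintegral_gaussProf {τ : ℝ} (hτ : 0 < τ) :
    ∫⁻ z : V, ENNReal.ofReal (gaussProf τ z)
      = ENNReal.ofReal ((2 * π) ^ (Module.finrank ℝ V : ℝ)) := by
  have h := lintegral_ofReal_exp_neg_mul_sq_norm (V := V) (b := 1 / (4 * τ)) (by positivity)
  have h1 : ∀ z : V, ENNReal.ofReal (gaussProf τ z)
      = ENNReal.ofReal ((π / τ) ^ (Module.finrank ℝ V / 2 : ℝ)) *
        ENNReal.ofReal (Real.exp (-(1 / (4 * τ)) * ‖z‖ ^ 2)) := by
    intro z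
    rw [← ENNReal.ofReal_mul (by positivity), gaussProf]
    congr 3
    ring
  simp_rw [h1]
  rw [lintegral_const_mul _ (by fun_prop), h, ← ENNReal.ofReal_mul (by positivity),
    ← Real.mul_rpow (by positivity) (by positivity)]
  congr 1
  rw [show π / τ * (π / (1 / (4 * τ))) = (2 * π) ^ (2 : ℝ) by
    rw [Real.rpow_two]; field_simp; ring, ← Real.rpow_mul (by positivity)]
  congr 1; ring

lemma exp_neg_mul_exp_mass (ν : Measure V) [IsFiniteMeasure ν] :
    ENNReal.ofReal (Real.exp (-ν.real Set.univ)) *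
      ENNReal.ofReal (Real.exp (ν Set.univ).toReal) = 1 := by
  rw [← ENNReal.ofReal_mul (by positivity), ← Real.exp_add]
  simp [Measure.real]

lemma lintegral_heatApprox (ν : Measure V) [IsFiniteMeasure ν] {τ : ℝ} (hτ : 0 < τ) :
    ∫⁻ z, heatApprox ν τ z = ENNReal.ofReal ((2 * π) ^ (Module.finrank ℝ V : ℝ)) := by
  have hm := measurable_ofReal_gaussProf (V := V) τ
  unfold heatApprox
  rw [lintegral_const_mul _ (measurable_jumpSeries _ hm)]
  unfold jumpSeries
  rw [lintegral_tsum fun n => ((measurable_jumpIter ν hm n).const_mul _).aemeasurable]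
  simp_rw [lintegral_const_mul _ (measurable_jumpIter ν hm _), lintegral_jumpIter ν hm,
    ← mul_assoc]
  rw [ENNReal.tsum_mul_right, tsum_inv_factorial_mul_pow (measure_ne_top _ _), ← mul_assoc,
    exp_neg_mul_exp_mass, one_mul, lintegral_gaussProf hτ]

end Mass

section Fiber

variable {E : Type*} [NormedAddCommGroup E] [InnerProductSpace ℝ E] [FiniteDimensional ℝ E]
  [MeasurableSpace E] [BorelSpace E]

/-- The free transport projection `(x, v) ↦ x - s v`. -/
def shear (s : ℝ) (z : WithLp 2 (E × E)) : E := z.fst - s • z.snd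

/-- The parametrization of the fibre of `shear s` over `w`. -/
def unshear (s : ℝ) (w y : E) : WithLp 2 (E × E) := WithLp.toLp 2 (w + s • y, y)

lemma continuous_shear (s : ℝ) : Continuous (shear s : WithLp 2 (E × E) → E) := by
  unfold shear; fun_prop

lemma continuous_unshear (s : ℝ) :
    Continuous (fun p : E × E => unshear s p.1 p.2) := by
  unfold unshear; fun_prop

lemma unshear_sub (s : ℝ) (w y : E) (j : WithLp 2 (E × E)) :
    unshear s w y - j = unshear s (w - shear s j) (y - j.snd) := by
  apply WithLp.ofLp_injective
  unfold unshear shear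
  ext
  · simp [smul_sub]
    abel
  · simp

lemma unshear_shear (s : ℝ) (z : WithLp 2 (E × E)) : unshear s (shear s z) z.snd = z := by
  apply WithLp.ofLp_injective
  unfold unshear shear
  ext <;> simp

lemma lintegral_jumpIter_unshear (ν : Measure (WithLp 2 (E × E))) [SFinite ν]
    {f : WithLp 2 (E × E) → ℝ≥0∞} (hf : Measurable f) (s : ℝ) (n : ℕ) (w : E) :
    ∫⁻ y, jumpIter ν f n (unshear s w y)
      = jumpIter (ν.map (shear s)) (fun w => ∫⁻ y, f (unshear s w y)) n w := by
  have hu := (continuous_unshear (E := E) s).measurable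
  have hg : Measurable (fun w : E => ∫⁻ y, f (unshear s w y)) :=
    (hf.comp hu).lintegral_prod_right'
  induction n generalizing w with
  | zero => rfl
  | succ n ih =>
    have hm := measurable_jumpIter ν hf n
    have hm' := measurable_jumpIter (ν.map (shear s)) hg n
    have hs := (continuous_shear (E := E) s).measurable
    simp only [jumpIter, jumpOp]
    rw [lintegral_lintegral_swap, lintegral_map (by fun_prop) hs]
    · congr 1; ext j
      simp_rw [unshear_sub]
      rw [lintegral_sub_right_eq_self (fun y => jumpIter ν f n (unshear s (w - shear s j) y)), ih]
    · have : Measurable (fun p : E × WithLp 2 (E × E) =>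
          jumpIter ν f n (unshear s w p.1 - p.2)) := by
        have h1 : Measurable (fun p : E × WithLp 2 (E × E) => unshear s w p.1) :=
          hu.comp (by fun_prop : Measurable fun p : E × WithLp 2 (E × E) => (w, p.1))
        fun_prop
      exact this.aemeasurable

lemma norm_sq_unshear (s : ℝ) (w y : E) :
    ‖unshear s w y‖ ^ 2
      = (1 + s ^ 2) * ‖y + (s / (1 + s ^ 2)) • w‖ ^ 2 + ‖w‖ ^ 2 / (1 + s ^ 2) := by
  have : (1 + s ^ 2) ≠ 0 := by positivity
  rw [WithLp.prod_norm_sq_eq_of_L2]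
  simp only [unshear, WithLp.toLp_fst, WithLp.toLp_snd]
  rw [norm_add_sq_real, norm_add_sq_real, inner_smul_right, inner_smul_right, norm_smul, norm_smul,
    mul_pow, mul_pow, real_inner_comm]
  simp only [Real.norm_eq_abs, sq_abs]
  field_simp
  ring

lemma lintegral_gaussProf_unshear {τ : ℝ} (hτ : 0 < τ) (s : ℝ) (w : E) :
    ∫⁻ y, ENNReal.ofReal (gaussProf τ (unshear s w y))
      = ENNReal.ofReal ((2 * π) ^ (Module.finrank ℝ E : ℝ)) *
        ENNReal.ofReal (gaussProf (τ * (1 + s ^ 2)) w) := by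
  set D : ℝ := (Module.finrank ℝ E : ℝ)
  have hD : (Module.finrank ℝ (WithLp 2 (E × E)) : ℝ) = 2 * D := by
    have : Module.finrank ℝ (WithLp 2 (E × E)) = Module.finrank ℝ (E × E) :=
      (WithLp.linearEquiv 2 ℝ (E × E)).finrank_eq
    rw [this, Module.finrank_prod]
    push_cast
    ring
  have h1 : ∀ y : E, ENNReal.ofReal (gaussProf τ (unshear s w y))
      = ENNReal.ofReal ((π / τ) ^ D * Real.exp (-(‖w‖ ^ 2 / (4 * (τ * (1 + s ^ 2)))))) *
        ENNReal.ofReal (Real.exp (-((1 + s ^ 2) / (4 * τ)) * ‖y + (s / (1 + s ^ 2)) • w‖ ^ 2)) := by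
    intro y
    rw [← ENNReal.ofReal_mul (by positivity), gaussProf, norm_sq_unshear, hD, mul_assoc,
      ← Real.exp_add]
    congr 3
    · ring
    · field_simp
      ring
  simp_rw [h1]
  rw [lintegral_const_mul _ (by fun_prop), lintegral_add_right_eq_self (fun y : E =>
    ENNReal.ofReal (Real.exp (-((1 + s ^ 2) / (4 * τ)) * ‖y‖ ^ 2))),
    lintegral_ofReal_exp_neg_mul_sq_norm (by positivity), ← ENNReal.ofReal_mul (by positivity),
    ← ENNReal.ofReal_mul (by positivity), gaussProf]
  congr 1
  have e1 : (π / τ) ^ D = ((π / τ) ^ 2) ^ (D / 2) := by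
    rw [← Real.rpow_two, ← Real.rpow_mul (by positivity)]; congr 1; ring
  have e2 : (2 * π) ^ D = ((2 * π) ^ 2) ^ (D / 2) := by
    rw [← Real.rpow_two, ← Real.rpow_mul (by positivity)]; congr 1; ring
  rw [e1, e2, mul_right_comm, ← Real.mul_rpow (by positivity) (by positivity),
    ← mul_assoc (((2 * π) ^ 2) ^ (D / 2)),
    ← Real.mul_rpow (by positivity) (by positivity)]
  congr 2
  field_simp
  ring

lemma lintegral_heatApprox_unshear (ν : Measure (WithLp 2 (E × E))) [IsFiniteMeasure ν] {τ : ℝ}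
    (hτ : 0 < τ) (s : ℝ) (w : E) :
    ∫⁻ y, heatApprox ν τ (unshear s w y)
      = ENNReal.ofReal ((2 * π) ^ (Module.finrank ℝ E : ℝ)) *
        heatApprox (ν.map (shear s)) (τ * (1 + s ^ 2)) w := by
  have hm := measurable_ofReal_gaussProf (V := WithLp 2 (E × E)) τ
  have hs := (continuous_shear (E := E) s).measurable
  have hu : Measurable (fun y : E => unshear s w y) :=
    (continuous_unshear (E := E) s).measurable.comp (by fun_prop : Measurable fun y : E => (w, y))
  have hmass : (ν.map (shear s)).real Set.univ = ν.real Set.univ := by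
    rw [map_measureReal_apply hs MeasurableSet.univ, Set.preimage_univ]
  have hj : Measurable (fun y : E => jumpSeries ν (fun z => ENNReal.ofReal (gaussProf τ z))
      (unshear s w y)) := (measurable_jumpSeries _ hm).comp hu
  have hi : ∀ n, Measurable (fun y : E => jumpIter ν (fun z => ENNReal.ofReal (gaussProf τ z)) n
      (unshear s w y)) := fun n => (measurable_jumpIter ν hm n).comp hu
  unfold heatApprox
  rw [lintegral_const_mul _ hj, mul_left_comm,
    ← jumpSeries_const_mul _ _ (measurable_ofReal_gaussProf _), hmass]
  congr 1
  simp_rw [← lintegral_gaussProf_unshear hτ]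
  unfold jumpSeries
  rw [lintegral_tsum fun n => ((hi n).const_mul _).aemeasurable]
  congr 1; ext n
  rw [← lintegral_jumpIter_unshear ν hm, lintegral_const_mul _ (hi n)]

end Fiber

section Split

variable {V : Type*} [NormedAddCommGroup V] [InnerProductSpace ℝ V] [FiniteDimensional ℝ V]
  [MeasurableSpace V] [BorelSpace V]

lemma levySymbol_add (μ ν : Measure V) [IsFiniteMeasure μ] [IsFiniteMeasure ν] (ζ : V) :
    levySymbol (μ + ν) ζ = levySymbol μ ζ + levySymbol ν ζ := by
  unfold levySymbol
  exact integral_add_measure ((integrable_const _).sub (integrable_cos_inner _ _))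
    ((integrable_const _).sub (integrable_cos_inner _ _))

lemma levySymbol_le_two_mul (ν : Measure V) [IsFiniteMeasure ν] (ζ : V) :
    levySymbol ν ζ ≤ 2 * ν.real Set.univ := by
  have h : levySymbol ν ζ ≤ ∫ _, (2 : ℝ) ∂ν := by
    refine integral_mono ((integrable_const _).sub (integrable_cos_inner _ _))
      (integrable_const _) fun y => ?_
    have := Real.neg_one_le_cos ⟪ζ, y⟫
    simp only
    linarith
  simpa [mul_comm] using h

/-- The constant in the decay estimate for truncated jump measures. -/
noncomputable def decayConst (V : Type*) [NormedAddCommGroup V] [InnerProductSpace ℝ V]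
    [FiniteDimensional ℝ V] [MeasurableSpace V] [BorelSpace V] (c α K k : ℝ) : ℝ :=
  Real.exp (k ^ 2 + k ^ 2 * K * (4 / α) ^ 2) * (Real.exp K * ∫ ζ : V, Real.exp (-(c * ‖ζ‖ ^ α)))

lemma decayConst_nonneg (c α K k : ℝ) : 0 ≤ decayConst V c α K k := by
  have hI : 0 ≤ ∫ ζ : V, Real.exp (-(c * ‖ζ‖ ^ α)) := integral_nonneg fun _ => by positivity
  unfold decayConst
  positivity

lemma heatApprox_split_le {μ ν : Measure V} [IsFiniteMeasure μ] [IsFiniteMeasure ν]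
    (hμ : μ.map (fun y => -y) = μ) {τ : ℝ} (hτ : 0 < τ) (hτ1 : τ ≤ 1) {c α K k M R : ℝ}
    (hc : 0 < c) (hα : 0 < α) (hk : 0 ≤ k)
    (hlow : ∀ ζ : V, c * ‖ζ‖ ^ α ≤ τ * ‖ζ‖ ^ 2 + levySymbol (μ + ν) ζ)
    (hK : 2 * ν.real Set.univ ≤ K)
    (hsupp : ∀ᵐ y ∂μ, ‖y‖ ≤ M) (hR : 1 ≤ R) (hM : k * M ≤ α / 2 * R)
    (hmom : ∫⁻ y, ENNReal.ofReal (‖y‖ ^ 2) ∂μ ≤ ENNReal.ofReal (K * R ^ (2 - α)))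
    {z : V} (hz : ‖z‖ = R) :
    heatApprox (μ + ν) τ z ≤ ENNReal.ofReal (decayConst V c α K k * R ^ (-k)) +
      jumpOp ν (heatApprox (μ + ν) τ) z := by
  refine (heatApprox_add_le z).trans ?_
  gcongr
  have hK0 : 0 ≤ K := (by positivity : 0 ≤ 2 * ν.real Set.univ).trans hK
  refine heatApprox_truncated_le hμ hτ hτ1 hc hα hK0 hk ?_ hsupp hR hM ?_ hz
  · intro ζ
    have h1 := hlow ζ
    rw [levySymbol_add] at h1
    linarith [levySymbol_le_two_mul ν ζ]
  · rw [integral_eq_lintegral_of_nonneg_ae (Filter.Eventually.of_forall fun y => by positivity)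
      (Continuous.aestronglyMeasurable (by fun_prop))]
    exact ENNReal.toReal_le_of_le_ofReal (by positivity) hmom

lemma map_neg_restrict {μ : Measure V} (hμ : μ.map (fun y => -y) = μ) {s : Set V}
    (hs : MeasurableSet s) (hsym : ∀ y, -y ∈ s ↔ y ∈ s) :
    (μ.restrict s).map (fun y => -y) = μ.restrict s := by
  conv_rhs => rw [← hμ, Measure.restrict_map measurable_neg hs]
  congr 2
  ext y
  exact (hsym y).symm

lemma rpow_neg_le_one_add {R β : ℝ} (hR : 1 ≤ R) (hβ : 0 ≤ β) :
    R ^ (-β) ≤ 2 ^ β * (1 + R) ^ (-β) := by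
  rw [Real.rpow_neg (by linarith), Real.rpow_neg (by linarith), ← div_eq_mul_inv,
    inv_eq_one_div, div_le_div_iff₀ (by positivity) (by positivity), one_mul,
    ← Real.mul_rpow (by norm_num) (by linarith)]
  gcongr
  linarith

lemma one_le_one_add {R β : ℝ} (hR0 : 0 ≤ R) (hR : R ≤ 1) (hβ : 0 ≤ β) :
    1 ≤ 2 ^ β * (1 + R) ^ (-β) := by
  rw [Real.rpow_neg (by linarith), ← div_eq_mul_inv, le_div_iff₀ (by positivity), one_mul]
  gcongr
  linarith

lemma heatApprox_stable_le (V : Type*) [NormedAddCommGroup V] [InnerProductSpace ℝ V]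
    [FiniteDimensional ℝ V] [MeasurableSpace V] [BorelSpace V]
    {B c α β : ℝ} (hB : 0 ≤ B) (hc : 0 < c) (hα : 0 < α) (hβ : 0 < β) :
    ∃ C : ℝ, 0 ≤ C ∧ ∀ (μ : Measure V) (_ : IsFiniteMeasure μ) (_ : μ.map (fun y => -y) = μ)
      (_ : ∀ r > 0, ∫⁻ y in {y | ‖y‖ ≤ r}, ENNReal.ofReal (‖y‖ ^ 2) ∂μ
        ≤ ENNReal.ofReal (B * r ^ (2 - α)))
      (_ : ∀ r > 0, μ {y | r < ‖y‖} ≤ ENNReal.ofReal (B * r ^ (-α)))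
      (_ : ∀ r > 0, ∀ F : V → ℝ≥0∞, Measurable F → ∫⁻ y in {y | r < ‖y‖}, F y ∂μ
        ≤ ENNReal.ofReal (B * r ^ (-β)) * ∫⁻ y, F y)
      (τ : ℝ) (_ : 0 < τ) (_ : τ ≤ 1)
      (_ : ∀ ζ : V, c * ‖ζ‖ ^ α ≤ τ * ‖ζ‖ ^ 2 + levySymbol μ ζ) (w : V),
      heatApprox μ τ w ≤ ENNReal.ofReal (C * (1 + ‖w‖) ^ (-β)) := by
  set ε : ℝ := α / (2 * β) with hεd
  have hε : 0 < ε := by positivity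
  set K : ℝ := 2 * (B * ε ^ (-α)) + B * ε ^ (2 - α) with hKd
  set I : ℝ := Real.exp 0 * ∫ ζ : V, Real.exp (-(c * ‖ζ‖ ^ α)) with hId
  have hI : 0 ≤ I := by
    have : 0 ≤ ∫ ζ : V, Real.exp (-(c * ‖ζ‖ ^ α)) := integral_nonneg fun _ => by positivity
    positivity
  set P : ℝ := (2 * π) ^ (Module.finrank ℝ V : ℝ) with hPd
  have hP : 0 ≤ P := by positivity
  have hD := decayConst_nonneg (V := V) c α K β
  set C1 : ℝ := decayConst V c α K β + B * ε ^ (-β) * P with hC1d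
  have hC1 : 0 ≤ C1 := by positivity
  refine ⟨(C1 + I) * 2 ^ β, by positivity, ?_⟩
  intro μ _ hμ hmom htail hdens τ hτ hτ1 hlow w
  rcases le_total ‖w‖ 1 with hw | hw
  · refine (heatApprox_le_const hμ hτ hc hα (K := 0) (by simpa using hlow) w).trans ?_
    refine ENNReal.ofReal_le_ofReal ?_
    rw [← hId]
    calc I = I * 1 := (mul_one _).symm
      _ ≤ (C1 + I) * (2 ^ β * (1 + ‖w‖) ^ (-β)) :=
        mul_le_mul (by linarith) (one_le_one_add (norm_nonneg _) hw hβ.le) (by norm_num)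
          (by positivity)
      _ = _ := by ring
  · set R := ‖w‖ with hR
    have hR0 : 0 < R := by linarith
    set M := ε * R with hM
    have hM0 : 0 < M := by positivity
    have hs1 : MeasurableSet {y : V | ‖y‖ ≤ M} := measurableSet_le measurable_norm measurable_const
    have hs2 : {y : V | ‖y‖ ≤ M}ᶜ = {y | M < ‖y‖} := by ext; simp
    have hsplit : μ.restrict {y | ‖y‖ ≤ M} + μ.restrict {y | M < ‖y‖} = μ := by
      rw [← hs2]; exact Measure.restrict_add_restrict_compl hs1
    have hMα : M ^ (-α) ≤ ε ^ (-α) := by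
      rw [hM, Real.mul_rpow hε.le hR0.le]
      exact mul_le_of_le_one_right (by positivity) (Real.rpow_le_one_of_one_le_of_nonpos hw (by linarith))
    have key := heatApprox_split_le (μ := μ.restrict {y | ‖y‖ ≤ M}) (ν := μ.restrict {y | M < ‖y‖})
      (map_neg_restrict hμ hs1 (by simp)) hτ hτ1 (K := K) (k := β) (M := M) (R := R) (z := w)
      hc hα hβ.le (by rwa [hsplit]) ?_ (ae_restrict_mem hs1) hw ?_ ?_ rfl
    · rw [hsplit] at key
      refine key.trans ?_
      have h2 : jumpOp (μ.restrict {y | M < ‖y‖}) (heatApprox μ τ) w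
          ≤ ENNReal.ofReal (B * M ^ (-β)) * ENNReal.ofReal P := by
        have hmeas := measurable_heatApprox μ τ
        refine (hdens M hM0 (fun y => heatApprox μ τ (w - y)) (by fun_prop)).trans ?_
        rw [lintegral_sub_left_eq_self (heatApprox μ τ), lintegral_heatApprox μ hτ]
      refine (add_le_add_right h2 _).trans ?_
      rw [← ENNReal.ofReal_mul (by positivity), ← ENNReal.ofReal_add (by positivity) (by positivity)]
      refine ENNReal.ofReal_le_ofReal ?_
      rw [hM, Real.mul_rpow hε.le hR0.le]
      calc _ = C1 * R ^ (-β) := by rw [hC1d]; ring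
        _ ≤ (C1 + I) * (2 ^ β * (1 + R) ^ (-β)) :=
          mul_le_mul (by linarith) (rpow_neg_le_one_add hw hβ.le) (by positivity) (by positivity)
        _ = _ := by ring
    · have h3 : (μ.restrict {y | M < ‖y‖}).real Set.univ ≤ B * M ^ (-α) := by
        rw [measureReal_restrict_apply_univ]
        exact ENNReal.toReal_le_of_le_ofReal (by positivity) (htail M hM0)
      have h4 : B * M ^ (-α) ≤ B * ε ^ (-α) := by gcongr
      have h5 : 0 ≤ B * ε ^ (2 - α) := by positivity
      rw [hKd]
      linarith
    · rw [hM, hεd]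
      apply le_of_eq
      field_simp
    · refine (hmom M hM0).trans (ENNReal.ofReal_le_ofReal ?_)
      rw [hM, Real.mul_rpow hε.le hR0.le, ← mul_assoc]
      gcongr
      rw [hKd]
      have : 0 ≤ B * ε ^ (-α) := by positivity
      linarith

end Split

section Stable

variable {E : Type*} [NormedAddCommGroup E] [InnerProductSpace ℝ E] [FiniteDimensional ℝ E]
  [MeasurableSpace E] [BorelSpace E]

/-- The characteristic properties of the Lévy measure of the rotationally invariant `α`-stable
process with symbol `‖ξ‖ ^ α`. -/
structure IsStableMeasure (Λ : Measure E) (α B : ℝ) : Prop where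
  lintegral_smul : ∀ t ≠ 0, ∀ F : E → ℝ≥0∞, Measurable F →
    ∫⁻ y, F (t • y) ∂Λ = ENNReal.ofReal (|t| ^ α) * ∫⁻ y, F y ∂Λ
  moment : ∀ r > 0, ∫⁻ y in {y | ‖y‖ ≤ r}, ENNReal.ofReal (‖y‖ ^ 2) ∂Λ
    ≤ ENNReal.ofReal (B * r ^ (2 - α))
  tail : ∀ r > 0, Λ {y | r < ‖y‖} ≤ ENNReal.ofReal (B * r ^ (-α))
  density : ∀ r > 0, ∀ F : E → ℝ≥0∞, Measurable F → ∫⁻ y in {y | r < ‖y‖}, F y ∂Λ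
    ≤ ENNReal.ofReal (B * r ^ (-(Module.finrank ℝ E + α))) * ∫⁻ y, F y
  symbol : ∀ ξ : E, ∫⁻ y, ENNReal.ofReal (1 - Real.cos ⟪ξ, y⟫) ∂Λ = ENNReal.ofReal (‖ξ‖ ^ α)
  sFinite : SFinite Λ

/-- The unnormalized stable Lévy measure. -/
noncomputable def powerMeasure (E : Type*) [NormedAddCommGroup E] [InnerProductSpace ℝ E]
    [FiniteDimensional ℝ E] [MeasurableSpace E] [BorelSpace E] (β : ℝ) : Measure E :=
  volume.withDensity (fun y => ENNReal.ofReal (‖y‖ ^ (-β)))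

lemma lintegral_powerMeasure {β : ℝ} {F : E → ℝ≥0∞} (hF : Measurable F) :
    ∫⁻ y, F y ∂(powerMeasure E β) = ∫⁻ y, ENNReal.ofReal (‖y‖ ^ (-β)) * F y := by
  unfold powerMeasure
  rw [lintegral_withDensity_eq_lintegral_mul _ (by fun_prop) hF]
  rfl

instance (β : ℝ) : SFinite (powerMeasure E β) := by unfold powerMeasure; infer_instance

lemma lintegral_powerMeasure_smul {α : ℝ} {t : ℝ} (ht : t ≠ 0) {F : E → ℝ≥0∞}
    (hF : Measurable F) :
    ∫⁻ y, F (t • y) ∂(powerMeasure E (Module.finrank ℝ E + α))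
      = ENNReal.ofReal (|t| ^ α) * ∫⁻ y, F y ∂(powerMeasure E (Module.finrank ℝ E + α)) := by
  set d := Module.finrank ℝ E
  have ht' : 0 < |t| := abs_pos.mpr ht
  rw [lintegral_powerMeasure (by fun_prop), lintegral_powerMeasure hF]
  set G : E → ℝ≥0∞ := fun y => ENNReal.ofReal (‖y‖ ^ (-((d : ℝ) + α))) * F y with hG
  have hGm : Measurable G := by fun_prop
  have h1 : ∫⁻ y, G (t • y) = ENNReal.ofReal |(t ^ d)⁻¹| * ∫⁻ y, G y := by
    have := Measure.map_addHaar_smul (volume : Measure E) ht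
    rw [← lintegral_map hGm (by fun_prop), this, lintegral_smul_measure, smul_eq_mul]
  have h2 : ∀ y : E, ENNReal.ofReal (‖y‖ ^ (-((d : ℝ) + α))) * F (t • y)
      = ENNReal.ofReal (|t| ^ ((d : ℝ) + α)) * G (t • y) := by
    intro y
    rw [hG]
    simp only
    rw [← mul_assoc, ← ENNReal.ofReal_mul (by positivity), norm_smul,
      Real.mul_rpow (by positivity) (by positivity), ← mul_assoc, Real.norm_eq_abs,
      ← Real.rpow_add ht']
    simp
  simp_rw [h2]
  rw [lintegral_const_mul _ (by fun_prop), h1, ← mul_assoc, ← ENNReal.ofReal_mul (by positivity),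
    Real.rpow_add ht', abs_inv, abs_pow, Real.rpow_natCast]
  congr 2
  field_simp

lemma powerMeasure_moment_lt_top [Nontrivial E] {α : ℝ} (hα : α < 2) :
    ∫⁻ y in {y : E | ‖y‖ ≤ 1}, ENNReal.ofReal (‖y‖ ^ 2)
      ∂(powerMeasure E (Module.finrank ℝ E + α)) < ∞ := by
  set d := Module.finrank ℝ E with hd
  have hd1 : 1 ≤ d := Module.finrank_pos
  have hs : MeasurableSet {y : E | ‖y‖ ≤ 1} := measurableSet_le measurable_norm measurable_const
  have h1 : IntegrableOn (fun x : E => ‖x‖ ^ (-((d : ℝ) + α)) * ‖x‖ ^ 2)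
      (Metric.ball (0 : E) 2) := by
    rw [integrableOn_fun_norm_addHaar volume (f := fun u : ℝ => u ^ (-((d : ℝ) + α)) * u ^ 2)]
    have h2 := (intervalIntegral.integrableOn_Ioo_rpow_iff (s := 1 - α) (t := 2) (by norm_num)).mpr
      (by linarith)
    refine h2.congr_fun (fun u hu => ?_) measurableSet_Ioo
    have hu0 : 0 < u := hu.1
    simp only [smul_eq_mul]
    rw [← Real.rpow_natCast, ← Real.rpow_natCast u 2, ← Real.rpow_add hu0, ← Real.rpow_add hu0]
    congr 1
    rw [← hd, Nat.cast_sub hd1]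
    push_cast
    ring
  rw [← lintegral_indicator hs, lintegral_powerMeasure (by
    exact Measurable.indicator (by fun_prop) hs)]
  refine lt_of_le_of_lt ?_ h1.lintegral_lt_top
  rw [← lintegral_indicator Metric.isOpen_ball.measurableSet]
  refine lintegral_mono fun y => ?_
  by_cases hy : ‖y‖ ≤ 1
  · have hy2 : y ∈ Metric.ball (0 : E) 2 := by simp; linarith
    rw [Set.indicator_of_mem (by exact hy), Set.indicator_of_mem hy2,
      ENNReal.ofReal_mul (by positivity)]
  · rw [Set.indicator_of_notMem (by exact hy)]
    simp

lemma powerMeasure_tail_lt_top {α : ℝ} (hα : 0 < α) :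
    powerMeasure E (Module.finrank ℝ E + α) {y : E | 1 < ‖y‖} < ∞ := by
  set d := Module.finrank ℝ E with hd
  have hs : MeasurableSet {y : E | 1 < ‖y‖} := measurableSet_lt measurable_const measurable_norm
  have h1 := finite_integral_one_add_norm (E := E) (μ := volume) (r := d + α) (by linarith)
  unfold powerMeasure
  rw [withDensity_apply _ hs]
  calc _ ≤ ∫⁻ y in {y : E | 1 < ‖y‖}, ENNReal.ofReal (2 ^ ((d : ℝ) + α)) *
        ENNReal.ofReal ((1 + ‖y‖) ^ (-((d : ℝ) + α))) := by
        refine setLIntegral_mono (by fun_prop) fun y hy => ?_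
        rw [← ENNReal.ofReal_mul (by positivity)]
        exact ENNReal.ofReal_le_ofReal (rpow_neg_le_one_add (le_of_lt hy) (by positivity))
    _ ≤ ∫⁻ y, ENNReal.ofReal (2 ^ ((d : ℝ) + α)) *
        ENNReal.ofReal ((1 + ‖y‖) ^ (-((d : ℝ) + α))) := setLIntegral_le_lintegral _ _
    _ < ∞ := by
        rw [lintegral_const_mul _ (by fun_prop)]
        exact ENNReal.mul_lt_top ENNReal.ofReal_lt_top h1

lemma powerMeasure_moment_eq {α r : ℝ} (hr : 0 < r) :
    ∫⁻ y in {y : E | ‖y‖ ≤ r}, ENNReal.ofReal (‖y‖ ^ 2) ∂(powerMeasure E (Module.finrank ℝ E + α))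
      = ENNReal.ofReal (r ^ (2 - α)) * ∫⁻ y in {y : E | ‖y‖ ≤ 1}, ENNReal.ofReal (‖y‖ ^ 2)
      ∂(powerMeasure E (Module.finrank ℝ E + α)) := by
  have hs : ∀ r : ℝ, MeasurableSet {y : E | ‖y‖ ≤ r} := fun r =>
    measurableSet_le measurable_norm measurable_const
  have hm : ∀ r : ℝ, Measurable ({y : E | ‖y‖ ≤ r}.indicator fun y => ENNReal.ofReal (‖y‖ ^ 2)) :=
    fun r => Measurable.indicator (by fun_prop) (hs r)
  have h := lintegral_powerMeasure_smul (E := E) (α := α) (t := r) hr.ne' (hm r)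
  rw [← lintegral_indicator (hs r), ← lintegral_indicator (hs 1)]
  have h2 : ∀ y : E, ({y : E | ‖y‖ ≤ r}.indicator fun y => ENNReal.ofReal (‖y‖ ^ 2)) (r • y)
      = ENNReal.ofReal (r ^ 2) *
        ({y : E | ‖y‖ ≤ 1}.indicator fun y => ENNReal.ofReal (‖y‖ ^ 2)) y := by
    intro y
    have h3 : ‖r • y‖ ≤ r ↔ ‖y‖ ≤ 1 := by
      rw [norm_smul, Real.norm_of_nonneg hr.le]
      exact mul_le_iff_le_one_right hr
    by_cases hy : ‖y‖ ≤ 1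
    · rw [Set.indicator_of_mem (by exact h3.mpr hy), Set.indicator_of_mem (by exact hy),
        ← ENNReal.ofReal_mul (by positivity), norm_smul, Real.norm_of_nonneg hr.le, mul_pow]
    · rw [Set.indicator_of_notMem (by exact fun h' => hy (h3.mp h')),
        Set.indicator_of_notMem (by exact hy), mul_zero]
  simp_rw [h2] at h
  rw [lintegral_const_mul _ (hm 1), abs_of_pos hr] at h
  have h4 : ENNReal.ofReal (r ^ α) ≠ 0 := by simpa using Real.rpow_pos_of_pos hr α
  rw [← ENNReal.mul_right_inj h4 ENNReal.ofReal_ne_top, ← h, ← mul_assoc,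
    ← ENNReal.ofReal_mul (by positivity), ← Real.rpow_add hr]
  rw [← Real.rpow_two]
  ring_nf

lemma powerMeasure_tail_eq {α r : ℝ} (hr : 0 < r) :
    powerMeasure E (Module.finrank ℝ E + α) {y : E | r < ‖y‖}
      = ENNReal.ofReal (r ^ (-α)) * powerMeasure E (Module.finrank ℝ E + α) {y : E | 1 < ‖y‖} := by
  have hs : ∀ r : ℝ, MeasurableSet {y : E | r < ‖y‖} := fun r =>
    measurableSet_lt measurable_const measurable_norm
  have hm : ∀ r : ℝ, Measurable ({y : E | r < ‖y‖}.indicator (1 : E → ℝ≥0∞)) :=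
    fun r => Measurable.indicator (by fun_prop) (hs r)
  have h := lintegral_powerMeasure_smul (E := E) (α := α) (t := r) hr.ne' (hm r)
  have h2 : ∀ y : E, ({y : E | r < ‖y‖}.indicator (1 : E → ℝ≥0∞)) (r • y)
      = ({y : E | 1 < ‖y‖}.indicator (1 : E → ℝ≥0∞)) y := by
    intro y
    have h3 : r < ‖r • y‖ ↔ 1 < ‖y‖ := by
      rw [norm_smul, Real.norm_of_nonneg hr.le]
      exact lt_mul_iff_one_lt_right hr
    simp [Set.indicator, h3]
  simp_rw [h2] at h
  rw [lintegral_indicator_one (hs _), lintegral_indicator_one (hs _), abs_of_pos hr] at h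
  rw [h, ← mul_assoc, ← ENNReal.ofReal_mul (by positivity), ← Real.rpow_add hr]
  simp

/-- The symbol of the unnormalized stable Lévy measure. -/
noncomputable def powerSymbol (β : ℝ) (ξ : E) : ℝ≥0∞ :=
  ∫⁻ y, ENNReal.ofReal (1 - Real.cos ⟪ξ, y⟫) ∂(powerMeasure E β)

lemma powerSymbol_smul {α : ℝ} {t : ℝ} (ht : t ≠ 0) (ξ : E) :
    powerSymbol (Module.finrank ℝ E + α) (t • ξ)
      = ENNReal.ofReal (|t| ^ α) * powerSymbol (Module.finrank ℝ E + α) ξ := by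
  unfold powerSymbol
  rw [← lintegral_powerMeasure_smul ht (F := fun y : E => ENNReal.ofReal (1 - Real.cos ⟪ξ, y⟫))
    (by fun_prop)]
  simp only [inner_smul_left, inner_smul_right, conj_trivial]

lemma powerSymbol_eq_of_norm_eq {β : ℝ} {ξ ξ' : E} (h : ‖ξ‖ = ‖ξ'‖) :
    powerSymbol β ξ = powerSymbol β ξ' := by
  unfold powerSymbol
  rw [lintegral_powerMeasure (by fun_prop), lintegral_powerMeasure (by fun_prop)]
  set T := Submodule.reflection (ℝ ∙ (ξ - ξ'))ᗮ with hT
  have hTξ : T ξ = ξ' := Submodule.reflection_sub h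
  rw [← (LinearIsometryEquiv.measurePreserving T).lintegral_comp
    (f := fun y => ENNReal.ofReal (‖y‖ ^ (-β)) * ENNReal.ofReal (1 - Real.cos ⟪ξ', y⟫))
    (by fun_prop)]
  congr 1; ext y
  rw [← hTξ, LinearIsometryEquiv.inner_map_map, LinearIsometryEquiv.norm_map]

lemma powerSymbol_lt_top [Nontrivial E] {α : ℝ} (hα : 0 < α) (hα2 : α < 2) (ξ : E) :
    powerSymbol (Module.finrank ℝ E + α) ξ < ∞ := by
  unfold powerSymbol
  have hs : MeasurableSet {y : E | ‖y‖ ≤ 1} := measurableSet_le measurable_norm measurable_const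
  have hsc : {y : E | ‖y‖ ≤ 1}ᶜ = {y | 1 < ‖y‖} := by ext; simp
  rw [← lintegral_add_compl _ hs, hsc]
  refine ENNReal.add_lt_top.mpr ⟨?_, ?_⟩
  · calc _ ≤ ∫⁻ y in {y : E | ‖y‖ ≤ 1}, ENNReal.ofReal (‖ξ‖ ^ 2) * ENNReal.ofReal (‖y‖ ^ 2)
          ∂(powerMeasure E (Module.finrank ℝ E + α)) := by
          refine lintegral_mono fun y => ?_
          rw [← ENNReal.ofReal_mul (by positivity)]
          refine ENNReal.ofReal_le_ofReal ?_
          have h1 := Real.one_sub_sq_div_two_le_cos (x := ⟪ξ, y⟫)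
          have h2 : ⟪ξ, y⟫ ^ 2 ≤ (‖ξ‖ * ‖y‖) ^ 2 := by
            rw [← sq_abs]
            gcongr
            exact abs_real_inner_le_norm _ _
          nlinarith [sq_nonneg ⟪ξ, y⟫]
      _ < ∞ := by
          rw [lintegral_const_mul _ (by fun_prop)]
          exact ENNReal.mul_lt_top ENNReal.ofReal_lt_top (powerMeasure_moment_lt_top hα2)
  · calc _ ≤ ∫⁻ y in {y : E | 1 < ‖y‖}, 2 ∂(powerMeasure E (Module.finrank ℝ E + α)) := by
          refine lintegral_mono fun y => ?_
          rw [show (2 : ℝ≥0∞) = ENNReal.ofReal 2 by simp]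
          refine ENNReal.ofReal_le_ofReal ?_
          linarith [Real.neg_one_le_cos ⟪ξ, y⟫]
      _ < ∞ := by
          rw [setLIntegral_const]
          exact ENNReal.mul_lt_top (by simp) (powerMeasure_tail_lt_top hα)

lemma powerSymbol_ne_zero {β : ℝ} {ξ : E} (hξ : ξ ≠ 0) :
    powerSymbol β ξ ≠ 0 := by
  have : Nontrivial E := ⟨ξ, 0, hξ⟩
  unfold powerSymbol
  rw [lintegral_powerMeasure (by fun_prop)]
  intro h
  rw [lintegral_eq_zero_iff (by fun_prop)] at h
  have h1 : (fun y : E => Real.cos ⟪ξ, y⟫) =ᵐ[volume] fun _ => 1 := by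
    filter_upwards [h, Measure.ae_ne volume (0 : E)] with y hy hy0
    have h2 : ENNReal.ofReal (‖y‖ ^ (-β)) ≠ 0 := by
      simpa using Real.rpow_pos_of_pos (norm_pos_iff.mpr hy0) _
    have h3 := (mul_eq_zero.mp hy).resolve_left h2
    rw [ENNReal.ofReal_eq_zero] at h3
    linarith [Real.cos_le_one ⟪ξ, y⟫]
  have h2 := (Continuous.ae_eq_iff_eq volume (by fun_prop) (by fun_prop)).mp h1
  have h3 := congrFun h2 ((π / ‖ξ‖ ^ 2) • ξ)
  simp only [inner_smul_right, real_inner_self_eq_norm_sq] at h3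
  rw [div_mul_cancel₀ _ (by simpa using hξ), Real.cos_pi] at h3
  norm_num at h3

lemma exists_isStableMeasure (E : Type*) [NormedAddCommGroup E] [InnerProductSpace ℝ E]
    [FiniteDimensional ℝ E] [MeasurableSpace E] [BorelSpace E] [Nontrivial E] {α : ℝ}
    (hα : 0 < α) (hα2 : α < 2) :
    ∃ (Λ : Measure E) (B : ℝ), 0 ≤ B ∧ IsStableMeasure Λ α B := by
  set d := Module.finrank ℝ E with hd
  obtain ⟨e, he⟩ := exists_norm_eq E (zero_le_one' ℝ)
  have he0 : e ≠ 0 := by rw [← norm_ne_zero_iff, he]; norm_num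
  set κ : ℝ≥0∞ := (powerSymbol ((d : ℝ) + α) e)⁻¹ with hκ
  have hκ0 : κ ≠ 0 := by simpa [hκ] using (powerSymbol_lt_top hα hα2 e).ne
  have hκt : κ ≠ ∞ := by simpa [hκ] using powerSymbol_ne_zero he0
  set P := powerMeasure E ((d : ℝ) + α) with hP
  set m := ∫⁻ y in {y : E | ‖y‖ ≤ 1}, ENNReal.ofReal (‖y‖ ^ 2) ∂P with hm
  have hmt : κ * m ≠ ∞ := ENNReal.mul_ne_top hκt (powerMeasure_moment_lt_top hα2).ne
  set T := P {y : E | 1 < ‖y‖} with hT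
  have hTt : κ * T ≠ ∞ := ENNReal.mul_ne_top hκt (powerMeasure_tail_lt_top hα).ne
  set B : ℝ := (κ * m).toReal + (κ * T).toReal + κ.toReal with hB
  have hB0 : 0 ≤ B := by positivity
  have hle : ∀ a : ℝ≥0∞, a ≠ ∞ → a.toReal ≤ B → ∀ u : ℝ, 0 ≤ u →
      a * ENNReal.ofReal u ≤ ENNReal.ofReal (B * u) := by
    intro a ha hab u hu
    rw [ENNReal.ofReal_mul hB0]
    gcongr
    rw [← ENNReal.ofReal_toReal ha]
    exact ENNReal.ofReal_le_ofReal hab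
  have n1 : 0 ≤ (κ * m).toReal := ENNReal.toReal_nonneg
  have n2 : 0 ≤ (κ * T).toReal := ENNReal.toReal_nonneg
  have n3 : 0 ≤ κ.toReal := ENNReal.toReal_nonneg
  refine ⟨κ • P, B, hB0, ⟨?_, ?_, ?_, ?_, ?_, inferInstance⟩⟩
  · intro t ht F hF
    rw [lintegral_smul_measure, lintegral_smul_measure, smul_eq_mul, smul_eq_mul,
      lintegral_powerMeasure_smul ht hF, mul_left_comm]
  · intro r hr
    rw [Measure.restrict_smul, lintegral_smul_measure, smul_eq_mul, powerMeasure_moment_eq hr,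
      mul_comm (ENNReal.ofReal _), ← mul_assoc]
    exact hle _ hmt (by linarith) _ (by positivity)
  · intro r hr
    rw [Measure.smul_apply, smul_eq_mul, powerMeasure_tail_eq hr,
      mul_comm (ENNReal.ofReal _), ← mul_assoc]
    exact hle _ hTt (by linarith) _ (by positivity)
  · intro r hr F hF
    have hs : MeasurableSet {y : E | r < ‖y‖} := measurableSet_lt measurable_const measurable_norm
    rw [Measure.restrict_smul, lintegral_smul_measure, smul_eq_mul, ← lintegral_indicator hs,
      lintegral_powerMeasure (hF.indicator hs)]
    have h1 : ∫⁻ y, ENNReal.ofReal (‖y‖ ^ (-((d : ℝ) + α))) * {y | r < ‖y‖}.indicator F y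
        ≤ ENNReal.ofReal (r ^ (-((d : ℝ) + α))) * ∫⁻ y, F y := by
      rw [← lintegral_const_mul _ hF]
      refine lintegral_mono fun y => ?_
      by_cases hy : r < ‖y‖
      · rw [Set.indicator_of_mem (by exact hy)]
        exact mul_le_mul_left (ENNReal.ofReal_le_ofReal (Real.rpow_le_rpow_of_nonpos hr hy.le
          (neg_nonpos.mpr (by positivity)))) _
      · rw [Set.indicator_of_notMem (by exact hy)]
        simp
    calc _ ≤ κ * (ENNReal.ofReal (r ^ (-((d : ℝ) + α))) * ∫⁻ y, F y) := by gcongr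
      _ = κ * ENNReal.ofReal (r ^ (-((d : ℝ) + α))) * ∫⁻ y, F y := by rw [mul_assoc]
      _ ≤ _ := by
        gcongr
        exact hle _ hκt (by linarith) _ (by positivity)
  · intro ξ
    rw [lintegral_smul_measure, smul_eq_mul]
    change κ * powerSymbol ((d : ℝ) + α) ξ = _
    rcases eq_or_ne ξ 0 with rfl | hξ
    · simp [powerSymbol, Real.zero_rpow hα.ne']
    · have hξ' := norm_pos_iff.mpr hξ
      rw [powerSymbol_eq_of_norm_eq (ξ' := ‖ξ‖ • e) (by simp [norm_smul, he]),
        powerSymbol_smul hξ'.ne', mul_left_comm, hκ,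
        ENNReal.inv_mul_cancel (powerSymbol_ne_zero he0) (powerSymbol_lt_top hα hα2 e).ne, mul_one,
        abs_norm]

end Stable

section Kinetic

variable {E : Type*} [NormedAddCommGroup E] [InnerProductSpace ℝ E] [FiniteDimensional ℝ E]
  [MeasurableSpace E] [BorelSpace E]

/-- The phase space jump `(u y, y)` created by a velocity jump `y` at time `u`. -/
def kinJump (p : ℝ × E) : WithLp 2 (E × E) := WithLp.toLp 2 (p.1 • p.2, p.2)

lemma continuous_kinJump : Continuous (kinJump : ℝ × E → WithLp 2 (E × E)) := by
  unfold kinJump; fun_prop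

/-- The jump measure on phase space accumulated over the time interval `[0, 1]`. -/
noncomputable def kinMeasure (m : Measure E) : Measure (WithLp 2 (E × E)) :=
  ((volume.restrict (Set.Icc (0 : ℝ) 1)).prod m).map kinJump

lemma lintegral_kinMeasure (m : Measure E) [SFinite m] {F : WithLp 2 (E × E) → ℝ≥0∞}
    (hF : Measurable F) :
    ∫⁻ z, F z ∂(kinMeasure m) = ∫⁻ u in Set.Icc (0 : ℝ) 1, ∫⁻ y, F (kinJump (u, y)) ∂m := by
  have hJ := (continuous_kinJump (E := E)).measurable
  unfold kinMeasure
  have hFJ : Measurable (fun p : ℝ × E => F (kinJump p)) := hF.comp hJ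
  rw [lintegral_map hF hJ, lintegral_prod _ hFJ.aemeasurable]

lemma kinMeasure_univ (m : Measure E) [SFinite m] : kinMeasure m Set.univ = m Set.univ := by
  rw [← lintegral_one, lintegral_kinMeasure m (F := fun _ => 1) measurable_const]
  simp

instance (m : Measure E) [IsFiniteMeasure m] : IsFiniteMeasure (kinMeasure m) :=
  ⟨by rw [kinMeasure_univ]; exact measure_lt_top _ _⟩

lemma kinMeasure_add (m₁ m₂ : Measure E) [SFinite m₁] [SFinite m₂] :
    kinMeasure (m₁ + m₂) = kinMeasure m₁ + kinMeasure m₂ := by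
  unfold kinMeasure
  rw [Measure.prod_add, Measure.map_add _ _ continuous_kinJump.measurable]

lemma map_neg_kinMeasure {m : Measure E} [SFinite m] (hm : m.map (fun y => -y) = m) :
    (kinMeasure m).map (fun z => -z) = kinMeasure m := by
  refine Measure.ext_of_lintegral _ fun F hF => ?_
  rw [lintegral_map hF (by fun_prop), lintegral_kinMeasure m (by fun_prop),
    lintegral_kinMeasure m hF]
  congr 1; ext u
  have hJ : Measurable (fun y : E => F (kinJump (u, y))) :=
    hF.comp (continuous_kinJump.measurable.comp (by fun_prop : Measurable fun y : E => (u, y)))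
  conv_rhs => rw [← hm, lintegral_map hJ (by fun_prop)]
  congr 1; ext y
  congr 1
  apply WithLp.ofLp_injective
  ext <;> simp [kinJump]

lemma shear_kinJump (s u : ℝ) (y : E) : shear s (kinJump (u, y)) = (u - s) • y := by
  simp [shear, kinJump, sub_smul]

lemma norm_sq_kinJump_le {u : ℝ} (hu : u ∈ Set.Icc (0 : ℝ) 1) (y : E) :
    ‖kinJump (u, y)‖ ^ 2 ≤ 2 * ‖y‖ ^ 2 := by
  rw [WithLp.prod_norm_sq_eq_of_L2]
  simp only [kinJump, WithLp.toLp_fst, WithLp.toLp_snd, norm_smul, mul_pow, Real.norm_eq_abs,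
    sq_abs]
  nlinarith [sq_nonneg ‖y‖, hu.1, hu.2, mul_nonneg hu.1 (sub_nonneg.mpr hu.2)]

lemma inner_kinJump (ζ : WithLp 2 (E × E)) (u : ℝ) (y : E) :
    ⟪ζ, kinJump (u, y)⟫ = ⟪u • ζ.fst + ζ.snd, y⟫ := by
  simp [WithLp.prod_inner_apply, kinJump, inner_add_left, inner_smul_left, inner_smul_right]

lemma lintegral_map_shear_le {Λ m : Measure E} {α B : ℝ} (hΛ : IsStableMeasure Λ α B) (hα : 0 ≤ α)
    [SFinite m] (hm : m ≤ Λ) {s : ℝ} (hs : s ∈ Set.Icc (0 : ℝ) 1) {F : E → ℝ≥0∞}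
    (hF : Measurable F) :
    ∫⁻ y, F y ∂((kinMeasure m).map (shear s)) ≤ ∫⁻ y, F y ∂Λ := by
  have hsh := (continuous_shear (E := E) s).measurable
  have hFs : Measurable (fun z => F (shear s z)) := hF.comp hsh
  rw [lintegral_map hF hsh, lintegral_kinMeasure m hFs]
  simp_rw [shear_kinJump]
  calc _ ≤ ∫⁻ u in Set.Icc (0 : ℝ) 1, ∫⁻ y, F y ∂Λ := by
        refine lintegral_mono_ae ?_
        have h1 : ∀ᵐ u : ℝ ∂(volume.restrict (Set.Icc (0 : ℝ) 1)), u ≠ s :=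
          ae_restrict_of_ae (Measure.ae_ne volume s)
        filter_upwards [h1, ae_restrict_mem measurableSet_Icc] with u hu hu01
        refine (lintegral_mono' hm le_rfl).trans ?_
        rw [hΛ.lintegral_smul (u - s) (sub_ne_zero.mpr hu) F hF]
        refine mul_le_of_le_one_left (by simp) ?_
        rw [ENNReal.ofReal_le_one]
        refine Real.rpow_le_one (abs_nonneg _) ?_ hα
        rw [abs_le]
        constructor <;> linarith [hu01.1, hu01.2, hs.1, hs.2]
    _ = _ := by simp

lemma map_shear_le {Λ m : Measure E} {α B : ℝ} (hΛ : IsStableMeasure Λ α B) (hα : 0 ≤ α)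
    [SFinite m] (hm : m ≤ Λ) {s : ℝ} (hs : s ∈ Set.Icc (0 : ℝ) 1) :
    (kinMeasure m).map (shear s) ≤ Λ := by
  refine Measure.le_iff.mpr fun S hS => ?_
  rw [← lintegral_indicator_one hS, ← lintegral_indicator_one hS]
  exact lintegral_map_shear_le hΛ hα hm hs (measurable_one.indicator hS)

lemma ofReal_levySymbol {V : Type*} [NormedAddCommGroup V] [InnerProductSpace ℝ V]
    [FiniteDimensional ℝ V] [MeasurableSpace V] [BorelSpace V] (ν : Measure V)
    [IsFiniteMeasure ν] (ζ : V) :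
    ENNReal.ofReal (levySymbol ν ζ) = ∫⁻ y, ENNReal.ofReal (1 - Real.cos ⟪ζ, y⟫) ∂ν := by
  unfold levySymbol
  rw [ofReal_integral_eq_lintegral_ofReal]
  · exact (integrable_const _).sub (integrable_cos_inner _ _)
  · exact Filter.Eventually.of_forall fun y => by simpa using Real.cos_le_one _

/-- The symbol of the kinetic process at time one. -/
noncomputable def kinSymbol (α : ℝ) (ζ : WithLp 2 (E × E)) : ℝ :=
  ∫ s in (0 : ℝ)..1, ‖s • ζ.fst + ζ.snd‖ ^ α

lemma continuous_kinSymbol_integrand {α : ℝ} (hα : 0 ≤ α) (ζ : WithLp 2 (E × E)) :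
    Continuous (fun s : ℝ => ‖s • ζ.fst + ζ.snd‖ ^ α) := by
  have : Continuous (fun s : ℝ => ‖s • ζ.fst + ζ.snd‖) := by fun_prop
  exact this.rpow_const fun _ => Or.inr hα

lemma ofReal_kinSymbol {Λ : Measure E} {α B : ℝ} (hΛ : IsStableMeasure Λ α B) (hα : 0 ≤ α)
    (ζ : WithLp 2 (E × E)) :
    ENNReal.ofReal (kinSymbol α ζ) = ∫⁻ u in Set.Icc (0 : ℝ) 1, ∫⁻ y,
      ENNReal.ofReal (1 - Real.cos ⟪ζ, kinJump (u, y)⟫) ∂Λ := by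
  simp_rw [inner_kinJump, hΛ.symbol]
  unfold kinSymbol
  rw [intervalIntegral.integral_of_le zero_le_one, ← integral_Icc_eq_integral_Ioc,
    ofReal_integral_eq_lintegral_ofReal]
  · exact (continuous_kinSymbol_integrand hα ζ).continuousOn.integrableOn_Icc
  · exact Filter.Eventually.of_forall fun y => by positivity

lemma norm_sq_smul_add_le {u : ℝ} (hu : u ∈ Set.Icc (0 : ℝ) 1) (ζ : WithLp 2 (E × E)) :
    ‖u • ζ.fst + ζ.snd‖ ^ 2 ≤ 2 * ‖ζ‖ ^ 2 := by
  rw [WithLp.prod_norm_sq_eq_of_L2]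
  have h1 : ‖u • ζ.fst + ζ.snd‖ ≤ ‖ζ.fst‖ + ‖ζ.snd‖ := by
    refine (norm_add_le _ _).trans ?_
    gcongr
    rw [norm_smul, Real.norm_of_nonneg hu.1]
    exact mul_le_of_le_one_left (norm_nonneg _) hu.2
  calc _ ≤ (‖ζ.fst‖ + ‖ζ.snd‖) ^ 2 := by gcongr
    _ ≤ _ := by nlinarith [sq_nonneg (‖ζ.fst‖ - ‖ζ.snd‖)]

lemma kinSymbol_ge {α : ℝ} (hα : 0 < α) (hα2 : α < 2) (ζ : WithLp 2 (E × E)) :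
    1 / 64 * ‖ζ‖ ^ α ≤ kinSymbol α ζ := by
  rcases eq_or_ne ζ 0 with rfl | hζ
  · simp [kinSymbol, Real.zero_rpow hα.ne']
  have hn : 0 < ‖ζ‖ := norm_pos_iff.mpr hζ
  have h1 : ∫ s in (0 : ℝ)..1, ‖s • ζ.fst + ζ.snd‖ ^ 2 * (2 * ‖ζ‖) ^ (-(2 - α))
      ≤ kinSymbol α ζ := by
    refine intervalIntegral.integral_mono_on zero_le_one ?_ ?_ ?_
    · exact Continuous.intervalIntegrable (by fun_prop) _ _
    · exact (continuous_kinSymbol_integrand hα.le ζ).intervalIntegrable _ _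
    · intro u hu
      have h2 := norm_sq_smul_add_le hu ζ
      have h3 : ‖u • ζ.fst + ζ.snd‖ ≤ 2 * ‖ζ‖ := by
        refine abs_le_of_sq_le_sq' ?_ (by positivity) |>.2
        nlinarith
      rw [Real.rpow_neg (by positivity), ← div_eq_mul_inv, div_le_iff₀ (by positivity)]
      rcases (norm_nonneg (u • ζ.fst + ζ.snd)).eq_or_lt with h0 | h0
      · rw [← h0]
        simp [Real.zero_rpow hα.ne']
      · calc ‖u • ζ.fst + ζ.snd‖ ^ 2
            = ‖u • ζ.fst + ζ.snd‖ ^ α * ‖u • ζ.fst + ζ.snd‖ ^ (2 - α) := by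
              rw [← Real.rpow_add h0, ← Real.rpow_two]; ring_nf
          _ ≤ _ := by gcongr
  refine le_trans ?_ h1
  rw [intervalIntegral.integral_mul_const]
  have h4 : ∫ s in (0 : ℝ)..1, ‖s • ζ.fst + ζ.snd‖ ^ 2
      = ‖ζ.fst‖ ^ 2 / 3 + ⟪ζ.fst, ζ.snd⟫ + ‖ζ.snd‖ ^ 2 := by
    have h5 : ∀ s : ℝ, ‖s • ζ.fst + ζ.snd‖ ^ 2
        = s ^ 2 * ‖ζ.fst‖ ^ 2 + s * (2 * ⟪ζ.fst, ζ.snd⟫) + ‖ζ.snd‖ ^ 2 := by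
      intro s
      rw [norm_add_sq_real, norm_smul, mul_pow, inner_smul_left, Real.norm_eq_abs, sq_abs]
      simp only [conj_trivial]
      ring
    simp_rw [h5]
    rw [intervalIntegral.integral_add, intervalIntegral.integral_add,
      intervalIntegral.integral_mul_const, intervalIntegral.integral_mul_const]
    · simp [integral_pow, integral_id]
      ring
    all_goals exact Continuous.intervalIntegrable (by fun_prop) _ _
  have h6 : ‖ζ‖ ^ 2 / 16 ≤ ∫ s in (0 : ℝ)..1, ‖s • ζ.fst + ζ.snd‖ ^ 2 := by
    rw [h4, WithLp.prod_norm_sq_eq_of_L2]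
    have h7 := neg_le_of_abs_le (abs_real_inner_le_norm ζ.fst ζ.snd)
    nlinarith [sq_nonneg (13 * ‖ζ.fst‖ - 24 * ‖ζ.snd‖), sq_nonneg ‖ζ.snd‖]
  have h8 : (2 : ℝ) ^ (-2 : ℝ) = 1 / 4 := by
    rw [Real.rpow_neg (by norm_num), Real.rpow_two]; norm_num
  calc 1 / 64 * ‖ζ‖ ^ α = ‖ζ‖ ^ 2 / 16 * ((2 : ℝ) ^ (-2 : ℝ) * ‖ζ‖ ^ (-(2 - α))) := by
        rw [show ‖ζ‖ ^ α = ‖ζ‖ ^ (2 : ℝ) * ‖ζ‖ ^ (-(2 - α)) by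
          rw [← Real.rpow_add hn]; ring_nf, Real.rpow_two, h8]
        ring
    _ ≤ ‖ζ‖ ^ 2 / 16 * ((2 : ℝ) ^ (-(2 - α)) * ‖ζ‖ ^ (-(2 - α))) := by
        gcongr
        · norm_num
        · linarith
    _ = ‖ζ‖ ^ 2 / 16 * (2 * ‖ζ‖) ^ (-(2 - α)) := by
        rw [Real.mul_rpow (by norm_num) hn.le]
    _ ≤ _ := by gcongr

/-- The part of `Λ` that consists of jumps larger than `δ`. -/
noncomputable def largeJumps (Λ : Measure E) (δ : ℝ) : Measure E := Λ.restrict {y | δ < ‖y‖}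

lemma measurableSet_norm_gt (δ : ℝ) : MeasurableSet {y : E | δ < ‖y‖} :=
  measurableSet_lt measurable_const measurable_norm

lemma measurableSet_norm_le (δ : ℝ) : MeasurableSet {y : E | ‖y‖ ≤ δ} :=
  measurableSet_le measurable_norm measurable_const

lemma largeJumps_le (Λ : Measure E) (δ : ℝ) : largeJumps Λ δ ≤ Λ := Measure.restrict_le_self

lemma IsStableMeasure.isFiniteMeasure_largeJumps {Λ : Measure E} {α B : ℝ}
    (hΛ : IsStableMeasure Λ α B) {δ : ℝ} (hδ : 0 < δ) : IsFiniteMeasure (largeJumps Λ δ) := by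
  refine ⟨?_⟩
  rw [largeJumps, Measure.restrict_apply_univ]
  exact (hΛ.tail δ hδ).trans_lt ENNReal.ofReal_lt_top

lemma IsStableMeasure.map_neg {Λ : Measure E} {α B : ℝ} (hΛ : IsStableMeasure Λ α B) :
    Λ.map (fun y => -y) = Λ := by
  refine Measure.ext_of_lintegral _ fun F hF => ?_
  rw [lintegral_map hF (by fun_prop)]
  simpa using hΛ.lintegral_smul (-1) (by norm_num) F hF

lemma IsStableMeasure.map_neg_largeJumps {Λ : Measure E} {α B : ℝ} (hΛ : IsStableMeasure Λ α B)
    (δ : ℝ) : (largeJumps Λ δ).map (fun y => -y) = largeJumps Λ δ :=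
  map_neg_restrict hΛ.map_neg (measurableSet_norm_gt δ) (by simp)

lemma levySymbol_kinMeasure_le {Λ : Measure E} {α B : ℝ} (hΛ : IsStableMeasure Λ α B) (hα : 0 ≤ α)
    {δ : ℝ} (hδ : 0 < δ) (ζ : WithLp 2 (E × E)) :
    levySymbol (kinMeasure (largeJumps Λ δ)) ζ ≤ kinSymbol α ζ := by
  have := hΛ.isFiniteMeasure_largeJumps hδ
  have hk : 0 ≤ kinSymbol α ζ :=
    intervalIntegral.integral_nonneg zero_le_one fun u _ => by positivity
  rw [← ENNReal.ofReal_le_ofReal_iff hk, ofReal_levySymbol, ofReal_kinSymbol hΛ hα,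
    lintegral_kinMeasure _ (by fun_prop)]
  exact lintegral_mono fun u => lintegral_mono' (largeJumps_le Λ δ) le_rfl

lemma kinSymbol_le_add {Λ : Measure E} {α B : ℝ} (hB : 0 ≤ B) (hΛ : IsStableMeasure Λ α B)
    (hα : 0 ≤ α) {δ : ℝ} (hδ : 0 < δ) (ζ : WithLp 2 (E × E)) :
    kinSymbol α ζ ≤ 2 * B * δ ^ (2 - α) * ‖ζ‖ ^ 2
      + levySymbol (kinMeasure (largeJumps Λ δ)) ζ := by
  have := hΛ.isFiniteMeasure_largeJumps hδ
  have hl := levySymbol_nonneg (kinMeasure (largeJumps Λ δ)) ζ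
  rw [← ENNReal.ofReal_le_ofReal_iff (by positivity), ENNReal.ofReal_add (by positivity) hl,
    ofReal_levySymbol, ofReal_kinSymbol hΛ hα, lintegral_kinMeasure _ (by fun_prop)]
  have hsc : {y : E | ‖y‖ ≤ δ}ᶜ = {y | δ < ‖y‖} := by ext; simp
  have hsf := hΛ.sFinite
  have hmeas : Measurable (fun p : ℝ × E => ENNReal.ofReal (1 - Real.cos ⟪ζ, kinJump p⟫)) := by
    have := (continuous_kinJump (E := E)).measurable
    fun_prop
  calc _ ≤ ∫⁻ u in Set.Icc (0 : ℝ) 1, (ENNReal.ofReal (2 * B * δ ^ (2 - α) * ‖ζ‖ ^ 2) +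
        ∫⁻ y, ENNReal.ofReal (1 - Real.cos ⟪ζ, kinJump (u, y)⟫) ∂(largeJumps Λ δ)) := by
        refine setLIntegral_mono' measurableSet_Icc fun u hu => ?_
        rw [← lintegral_add_compl _ (measurableSet_norm_le δ), hsc, largeJumps]
        gcongr
        calc _ ≤ ∫⁻ y in {y : E | ‖y‖ ≤ δ}, ENNReal.ofReal (2 * ‖ζ‖ ^ 2) *
              ENNReal.ofReal (‖y‖ ^ 2) ∂Λ := by
              refine lintegral_mono fun y => ?_
              rw [← ENNReal.ofReal_mul (by positivity), inner_kinJump]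
              refine ENNReal.ofReal_le_ofReal ?_
              set w := u • ζ.fst + ζ.snd
              have h1 := Real.one_sub_sq_div_two_le_cos (x := ⟪w, y⟫)
              have h2 : ⟪w, y⟫ ^ 2 ≤ (‖w‖ * ‖y‖) ^ 2 := by
                rw [← sq_abs]
                gcongr
                exact abs_real_inner_le_norm _ _
              have h3 : ‖w‖ ^ 2 * ‖y‖ ^ 2 ≤ 2 * ‖ζ‖ ^ 2 * ‖y‖ ^ 2 := by
                gcongr
                exact norm_sq_smul_add_le hu ζ
              nlinarith [sq_nonneg ⟪w, y⟫]
          _ ≤ ENNReal.ofReal (2 * ‖ζ‖ ^ 2) * ENNReal.ofReal (B * δ ^ (2 - α)) := by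
              rw [lintegral_const_mul _ (by fun_prop)]
              gcongr
              exact hΛ.moment δ hδ
          _ = _ := by
              rw [← ENNReal.ofReal_mul (by positivity)]
              congr 1; ring
    _ = _ := by
        rw [lintegral_add_left measurable_const]
        simp

lemma levySymbol_map_shear (ν : Measure (WithLp 2 (E × E))) (s : ℝ) (ξ : E) :
    levySymbol (ν.map (shear s)) ξ = levySymbol ν (WithLp.toLp 2 (ξ, -(s • ξ))) := by
  unfold levySymbol
  rw [integral_map (continuous_shear s).measurable.aemeasurable
    (Continuous.aestronglyMeasurable (by fun_prop))]
  congr 1; ext z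
  simp [shear, WithLp.prod_inner_apply, inner_smul_left, inner_smul_right,
    sub_eq_add_neg, inner_add_right, inner_neg_right]

end Kinetic

section KineticBound

variable {E : Type*} [NormedAddCommGroup E] [InnerProductSpace ℝ E] [FiniteDimensional ℝ E]
  [MeasurableSpace E] [BorelSpace E]

lemma exists_heatApprox_shear_le {Λ : Measure E} {α B : ℝ} (hB : 0 ≤ B)
    (hΛ : IsStableMeasure Λ α B) (hα : 0 < α) (hα2 : α < 2) :
    ∃ C : ℝ, 0 ≤ C ∧ ∀ δ > 0, ∀ τ > 0, 2 * B * δ ^ (2 - α) ≤ τ → τ ≤ 1 / 2 →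
      ∀ s ∈ Set.Icc (0 : ℝ) 1, ∀ w : E,
      heatApprox ((kinMeasure (largeJumps Λ δ)).map (shear s)) (τ * (1 + s ^ 2)) w
        ≤ ENNReal.ofReal (C * (1 + ‖w‖) ^ (-(Module.finrank ℝ E + α))) := by
  obtain ⟨C, hC, h⟩ := heatApprox_stable_le E (B := B) (c := 1 / 64) (α := α)
    (β := Module.finrank ℝ E + α) hB (by norm_num) hα (by positivity)
  refine ⟨C, hC, fun δ hδ τ hτ hτδ hτ1 s hs w => ?_⟩
  have := hΛ.isFiniteMeasure_largeJumps hδ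
  have hle := map_shear_le hΛ hα.le (largeJumps_le Λ δ) hs
  have hsh := (continuous_shear (E := E) s).measurable
  have hs2 : s ^ 2 ≤ 1 := pow_le_one₀ hs.1 hs.2
  refine h _ inferInstance ?_ ?_ ?_ ?_ _ (by positivity) (by nlinarith) ?_ w
  · rw [Measure.map_map measurable_neg hsh]
    conv_rhs => rw [← map_neg_kinMeasure (hΛ.map_neg_largeJumps δ),
      Measure.map_map hsh measurable_neg]
    congr 1
    ext z
    simp only [shear, Function.comp_apply, WithLp.neg_fst, WithLp.neg_snd, smul_neg]
    abel
  · exact fun r hr => (lintegral_mono' (Measure.restrict_mono le_rfl hle) le_rfl).trans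
      (hΛ.moment r hr)
  · exact fun r hr => (hle _).trans (hΛ.tail r hr)
  · exact fun r hr F hF => (lintegral_mono' (Measure.restrict_mono le_rfl hle) le_rfl).trans
      (hΛ.density r hr F hF)
  · intro ξ
    set ζ : WithLp 2 (E × E) := WithLp.toLp 2 (ξ, -(s • ξ)) with hζ
    have hn : ‖ζ‖ ^ 2 = (1 + s ^ 2) * ‖ξ‖ ^ 2 := by
      rw [WithLp.prod_norm_sq_eq_of_L2]
      simp only [hζ, WithLp.toLp_fst, WithLp.toLp_snd, norm_neg, norm_smul, mul_pow,
        Real.norm_eq_abs, sq_abs]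
      ring
    have hn2 : ‖ξ‖ ≤ ‖ζ‖ := by
      refine abs_le_of_sq_le_sq' ?_ (norm_nonneg _) |>.2
      rw [hn]
      nlinarith [sq_nonneg (s * ‖ξ‖)]
    rw [levySymbol_map_shear, ← hζ]
    have h1 := kinSymbol_le_add hB hΛ hα.le hδ ζ
    have h2 := kinSymbol_ge hα hα2 ζ
    have h3 : ‖ξ‖ ^ α ≤ ‖ζ‖ ^ α := by gcongr
    have h4 : 2 * B * δ ^ (2 - α) * ‖ζ‖ ^ 2 ≤ τ * ‖ζ‖ ^ 2 := by gcongr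
    rw [hn] at h4 h1
    linarith

lemma jumpOp_kinMeasure_le {Λ : Measure E} {α B : ℝ} (hΛ : IsStableMeasure Λ α B)
    {δ τ M : ℝ} (hδ : 0 < δ) (hτ : 0 < τ) (hM : 0 < M) (z : WithLp 2 (E × E)) :
    jumpOp (kinMeasure ((largeJumps Λ δ).restrict {y | M < ‖y‖}))
        (heatApprox (kinMeasure (largeJumps Λ δ)) τ) z ≤
      ENNReal.ofReal (B * M ^ (-(Module.finrank ℝ E + α))) *
        ∫⁻ u in Set.Icc (0 : ℝ) 1, ENNReal.ofReal ((2 * π) ^ (Module.finrank ℝ E : ℝ)) *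
          heatApprox ((kinMeasure (largeJumps Λ δ)).map (shear u)) (τ * (1 + u ^ 2))
            (shear u z) := by
  have := hΛ.isFiniteMeasure_largeJumps hδ
  have hmeas := measurable_heatApprox (kinMeasure (largeJumps Λ δ)) τ
  unfold jumpOp
  rw [lintegral_kinMeasure _ (by fun_prop), ← lintegral_const_mul' _ _ ENNReal.ofReal_ne_top]
  refine lintegral_mono fun u => ?_
  have hshift : ∀ y, z - kinJump (u, y) = unshear u (shear u z) (z.snd - y) := by
    intro y
    conv_lhs => rw [← unshear_shear u z]
    rw [unshear_sub, shear_kinJump]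
    simp [kinJump]
  have hu : Measurable (fun y => unshear u (shear u z) y) :=
    (continuous_unshear (E := E) u).measurable.comp (by fun_prop : Measurable fun y : E =>
      (shear u z, y))
  have hg : Measurable (fun y => heatApprox (kinMeasure (largeJumps Λ δ)) τ
    (unshear u (shear u z) y)) := hmeas.comp hu
  have hg' : Measurable (fun y => heatApprox (kinMeasure (largeJumps Λ δ)) τ
    (unshear u (shear u z) (z.snd - y))) := hg.comp (measurable_const.sub measurable_id)
  simp_rw [hshift]
  refine (lintegral_mono' (Measure.restrict_mono le_rfl (largeJumps_le Λ δ)) le_rfl).trans ?_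
  refine (hΛ.density M hM _ hg').trans ?_
  rw [lintegral_sub_left_eq_self (fun y => heatApprox (kinMeasure (largeJumps Λ δ)) τ
    (unshear u (shear u z) y)), lintegral_heatApprox_unshear _ hτ]

lemma exists_heatApprox_kinMeasure_le {Λ : Measure E} {α B : ℝ} (hB : 0 ≤ B)
    (hΛ : IsStableMeasure Λ α B) (hα : 0 < α) (hα2 : α < 2) :
    ∃ C : ℝ, 0 ≤ C ∧ ∀ δ > 0, ∀ τ > 0, 2 * B * δ ^ (2 - α) ≤ τ → τ ≤ 1 / 2 →
      ∀ z : WithLp 2 (E × E), 1 ≤ ‖z‖ → heatApprox (kinMeasure (largeJumps Λ δ)) τ z ≤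
        ENNReal.ofReal (C * ‖z‖ ^ (-(2 * (Module.finrank ℝ E + α)))) +
        ENNReal.ofReal (C * ‖z‖ ^ (-(Module.finrank ℝ E + α))) * ∫⁻ u in Set.Icc (0 : ℝ) 1,
          ENNReal.ofReal ((1 + ‖z.fst - u • z.snd‖) ^ (-(Module.finrank ℝ E + α))) := by
  obtain ⟨C₀, hC₀, hstable⟩ := exists_heatApprox_shear_le hB hΛ hα hα2
  set β : ℝ := Module.finrank ℝ E + α with hβd
  have hβ : 0 < β := by positivity
  set ε : ℝ := α / (8 * β) with hεd
  have hε : 0 < ε := by positivity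
  set K : ℝ := 2 * (B * ε ^ (-α)) + 2 * (B * ε ^ (2 - α)) with hKd
  set P : ℝ := (2 * π) ^ (Module.finrank ℝ E : ℝ) with hPd
  have hP : 0 ≤ P := by positivity
  set D : ℝ := decayConst (WithLp 2 (E × E)) (1 / 64) α K (2 * β)
  have hD : 0 ≤ D := decayConst_nonneg (V := WithLp 2 (E × E)) (1 / 64) α K (2 * β)
  have hG : 0 ≤ B * ε ^ (-β) * P * C₀ := by positivity
  refine ⟨D + B * ε ^ (-β) * P * C₀, by positivity, fun δ hδ τ hτ hτδ hτ1 z hz => ?_⟩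
  have := hΛ.isFiniteMeasure_largeJumps hδ
  set R := ‖z‖ with hR
  have hR0 : 0 < R := by linarith
  set M := ε * R with hM
  have hM0 : 0 < M := by positivity
  set m := largeJumps Λ δ with hm
  have hmΛ : m ≤ Λ := largeJumps_le Λ δ
  have hs1 : MeasurableSet {y : E | ‖y‖ ≤ M} := measurableSet_norm_le M
  have hs2 : {y : E | ‖y‖ ≤ M}ᶜ = {y | M < ‖y‖} := by ext; simp
  have hsplit : kinMeasure (m.restrict {y | ‖y‖ ≤ M}) + kinMeasure (m.restrict {y | M < ‖y‖})
      = kinMeasure m := by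
    rw [← hs2, ← kinMeasure_add, Measure.restrict_add_restrict_compl hs1]
  have hMα : M ^ (-α) ≤ ε ^ (-α) := by
    rw [hM, Real.mul_rpow hε.le hR0.le]
    exact mul_le_of_le_one_right (by positivity)
      (Real.rpow_le_one_of_one_le_of_nonpos hz (by linarith))
  have key := heatApprox_split_le (μ := kinMeasure (m.restrict {y | ‖y‖ ≤ M}))
    (ν := kinMeasure (m.restrict {y | M < ‖y‖}))
    (map_neg_kinMeasure (map_neg_restrict (hΛ.map_neg_largeJumps δ) hs1 (by simp))) hτ
    (by linarith) (c := 1 / 64) (α := α) (K := K) (k := 2 * β) (M := 2 * M) (R := R) (z := z)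
    (by norm_num) hα (by positivity) ?_ ?_ ?_ hz ?_ ?_ rfl
  · rw [hsplit] at key
    refine key.trans ?_
    refine add_le_add (ENNReal.ofReal_le_ofReal ?_)
      ((jumpOp_kinMeasure_le hΛ hδ hτ hM0 z).trans ?_)
    · exact mul_le_mul_of_nonneg_right (by linarith) (by positivity)
    · calc _ ≤ ENNReal.ofReal (B * M ^ (-β)) * ∫⁻ u in Set.Icc (0 : ℝ) 1,
            ENNReal.ofReal (P * C₀) * ENNReal.ofReal ((1 + ‖z.fst - u • z.snd‖) ^ (-β)) := by
            refine mul_le_mul' le_rfl (setLIntegral_mono' measurableSet_Icc fun u hu => ?_)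
            refine (mul_le_mul' le_rfl (hstable δ hδ τ hτ hτδ hτ1 u hu (shear u z))).trans ?_
            rw [← ENNReal.ofReal_mul hP, ← ENNReal.ofReal_mul (by positivity), shear, mul_assoc]
        _ = ENNReal.ofReal (B * ε ^ (-β) * P * C₀ * R ^ (-β)) * ∫⁻ u in Set.Icc (0 : ℝ) 1,
            ENNReal.ofReal ((1 + ‖z.fst - u • z.snd‖) ^ (-β)) := by
            rw [lintegral_const_mul' _ _ ENNReal.ofReal_ne_top, ← mul_assoc,
              ← ENNReal.ofReal_mul (by positivity), hM, Real.mul_rpow hε.le hR0.le]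
            congr 2
            ring
        _ ≤ _ := by
            gcongr
            linarith
  · rw [hsplit]
    intro ζ
    have h1 := kinSymbol_le_add hB hΛ hα.le hδ ζ
    have h2 := kinSymbol_ge hα hα2 ζ
    have h4 : 2 * B * δ ^ (2 - α) * ‖ζ‖ ^ 2 ≤ τ * ‖ζ‖ ^ 2 := by gcongr
    linarith
  · have h3 : (kinMeasure (m.restrict {y | M < ‖y‖})).real Set.univ ≤ B * M ^ (-α) := by
      rw [measureReal_def, kinMeasure_univ, Measure.restrict_apply_univ]
      exact ENNReal.toReal_le_of_le_ofReal (by positivity) ((hmΛ _).trans (hΛ.tail M hM0))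
    have h4 : B * M ^ (-α) ≤ B * ε ^ (-α) := by gcongr
    have h5 : 0 ≤ B * ε ^ (2 - α) := by positivity
    rw [hKd]
    linarith
  · have hs3 : MeasurableSet {x : WithLp 2 (E × E) | ‖x‖ ≤ 2 * M} :=
      measurableSet_le measurable_norm measurable_const
    unfold kinMeasure
    rw [ae_map_iff continuous_kinJump.measurable.aemeasurable hs3]
    have h6 : ∀ᵐ p : ℝ × E ∂((volume.restrict (Set.Icc (0 : ℝ) 1)).prod
        (m.restrict {y | ‖y‖ ≤ M})), p ∈ Set.Icc (0 : ℝ) 1 ×ˢ {y : E | ‖y‖ ≤ M} := by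
      rw [Measure.prod_restrict]
      exact ae_restrict_mem (measurableSet_Icc.prod hs1)
    filter_upwards [h6] with p hp
    refine abs_le_of_sq_le_sq' ?_ (by positivity) |>.2
    refine (norm_sq_kinJump_le hp.1 p.2).trans ?_
    have : ‖p.2‖ ^ 2 ≤ M ^ 2 := by
      gcongr
      exact hp.2
    nlinarith
  · rw [hM, hεd]
    apply le_of_eq
    field_simp
    ring
  · rw [lintegral_kinMeasure _ (by fun_prop)]
    calc _ ≤ ∫⁻ u in Set.Icc (0 : ℝ) 1, ENNReal.ofReal (2 * (B * M ^ (2 - α))) := by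
          refine setLIntegral_mono' measurableSet_Icc fun u hu => ?_
          calc _ ≤ ∫⁻ y in {y : E | ‖y‖ ≤ M}, ENNReal.ofReal 2 * ENNReal.ofReal (‖y‖ ^ 2) ∂Λ := by
                refine lintegral_mono' (Measure.restrict_mono le_rfl hmΛ) fun y => ?_
                rw [← ENNReal.ofReal_mul (by norm_num)]
                exact ENNReal.ofReal_le_ofReal (norm_sq_kinJump_le hu y)
            _ ≤ _ := by
                rw [lintegral_const_mul _ (by fun_prop), ENNReal.ofReal_mul (by norm_num)]
                gcongr
                exact hΛ.moment M hM0
      _ = ENNReal.ofReal (2 * (B * M ^ (2 - α))) := by simp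
      _ ≤ _ := by
          refine ENNReal.ofReal_le_ofReal ?_
          rw [hM, Real.mul_rpow hε.le hR0.le, ← mul_assoc, ← mul_assoc]
          gcongr
          rw [hKd]
          have : 0 ≤ B * ε ^ (-α) := by positivity
          linarith

end KineticBound

section Profile

variable {E : Type*} [NormedAddCommGroup E] [InnerProductSpace ℝ E]

/-- The distance from `z.fst` to the segment `[0, z.snd]`. -/
noncomputable def segDist (z : WithLp 2 (E × E)) : ℝ :=
  ⨅ s : Set.Icc (0 : ℝ) 1, ‖z.fst - (s : ℝ) • z.snd‖

/-- The function `𝒩_β` on phase space. -/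
noncomputable def kinProfile (β : ℝ) (z : WithLp 2 (E × E)) : ℝ :=
  (1 + ‖z‖) ^ (-(1 + β)) * (1 + segDist z) ^ (1 - β)

lemma segDist_nonneg (z : WithLp 2 (E × E)) : 0 ≤ segDist z :=
  Real.iInf_nonneg fun _ => norm_nonneg _

lemma segDist_le (z : WithLp 2 (E × E)) {u : ℝ} (hu : u ∈ Set.Icc (0 : ℝ) 1) :
    segDist z ≤ ‖z.fst - u • z.snd‖ :=
  ciInf_le (f := fun s : Set.Icc (0 : ℝ) 1 => ‖z.fst - (s : ℝ) • z.snd‖)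
    ⟨0, by rintro _ ⟨s, rfl⟩; exact norm_nonneg _⟩ ⟨u, hu⟩

lemma norm_fst_le_norm_toLp (z : WithLp 2 (E × E)) : ‖z.fst‖ ≤ ‖z‖ := by
  refine abs_le_of_sq_le_sq' ?_ (norm_nonneg _) |>.2
  rw [WithLp.prod_norm_sq_eq_of_L2]
  nlinarith [sq_nonneg ‖z.snd‖]

lemma segDist_le_norm (z : WithLp 2 (E × E)) : segDist z ≤ ‖z‖ := by
  refine (segDist_le z (u := 0) (by simp)).trans ?_
  simpa using norm_fst_le_norm_toLp z

lemma half_norm_le_of_norm_snd_le (z : WithLp 2 (E × E)) (h : ‖z.snd‖ ≤ ‖z‖ / 4) {u : ℝ}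
    (hu : u ∈ Set.Icc (0 : ℝ) 1) : ‖z‖ / 2 ≤ ‖z.fst - u • z.snd‖ := by
  have h1 : ‖z.fst‖ - ‖u • z.snd‖ ≤ ‖z.fst - u • z.snd‖ := norm_sub_norm_le _ _
  have h2 : ‖u • z.snd‖ ≤ ‖z.snd‖ := by
    rw [norm_smul, Real.norm_of_nonneg hu.1]
    exact mul_le_of_le_one_left (norm_nonneg _) hu.2
  have h3 : 3 * ‖z‖ / 4 ≤ ‖z.fst‖ := by
    refine abs_le_of_sq_le_sq' ?_ (norm_nonneg _) |>.2
    have h4 := WithLp.prod_norm_sq_eq_of_L2 z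
    nlinarith [norm_nonneg z.snd, norm_nonneg z]
  linarith

lemma abs_sub_mul_norm_le (x v : E) (hv : v ≠ 0) (u : ℝ) :
    |u - ⟪x, v⟫ / ‖v‖ ^ 2| * ‖v‖ ≤ ‖x - u • v‖ := by
  have hn : 0 < ‖v‖ := norm_pos_iff.mpr hv
  have h1 := abs_real_inner_le_norm (x - u • v) v
  have h2 : ⟪x - u • v, v⟫ = -((u - ⟪x, v⟫ / ‖v‖ ^ 2) * ‖v‖ ^ 2) := by
    rw [inner_sub_left, inner_smul_left, real_inner_self_eq_norm_sq]
    simp only [conj_trivial]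
    field_simp
    ring
  have h3 : |u - ⟪x, v⟫ / ‖v‖ ^ 2| * ‖v‖ ^ 2 = |u - ⟪x, v⟫ / ‖v‖ ^ 2| * ‖v‖ * ‖v‖ := by ring
  rw [h2, abs_neg, abs_mul, abs_of_nonneg (sq_nonneg ‖v‖), h3] at h1
  exact le_of_mul_le_mul_right h1 hn

lemma lintegral_add_mul_abs_rpow {A b β : ℝ} (hA : 0 < A) (hb : 0 < b) :
    ∫⁻ u : ℝ, ENNReal.ofReal ((A + b * |u|) ^ (-β)) =
      ENNReal.ofReal (A ^ (1 - β) / b) * ∫⁻ u : ℝ, ENNReal.ofReal ((1 + ‖u‖) ^ (-β)) := by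
  have hab : b / A ≠ 0 := by positivity
  have h1 : ∀ u : ℝ, ENNReal.ofReal ((A + b * |u|) ^ (-β))
      = ENNReal.ofReal (A ^ (-β)) * ENNReal.ofReal ((1 + ‖b / A * u‖) ^ (-β)) := by
    intro u
    rw [← ENNReal.ofReal_mul (by positivity), ← Real.mul_rpow hA.le (by positivity), norm_mul,
      Real.norm_of_nonneg (by positivity : 0 ≤ b / A), Real.norm_eq_abs]
    congr 2
    field_simp
  simp_rw [h1]
  rw [lintegral_const_mul' _ _ ENNReal.ofReal_ne_top]
  have hG : Measurable (fun u : ℝ => ENNReal.ofReal ((1 + ‖u‖) ^ (-β))) := by fun_prop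
  rw [← lintegral_map hG (measurable_const_mul (b / A)), Real.map_volume_mul_left hab,
    lintegral_smul_measure, smul_eq_mul, ← mul_assoc, ← ENNReal.ofReal_mul (by positivity),
    abs_of_pos (by positivity), Real.rpow_sub hA, Real.rpow_neg hA.le, Real.rpow_one]
  congr 2
  field_simp

lemma exists_lintegral_segment_le {β : ℝ} (hβ : 1 < β) :
    ∃ C : ℝ, 0 ≤ C ∧ ∀ z : WithLp 2 (E × E), 0 < ‖z‖ →
      ∫⁻ u in Set.Icc (0 : ℝ) 1, ENNReal.ofReal ((1 + ‖z.fst - u • z.snd‖) ^ (-β))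
        ≤ ENNReal.ofReal (C * ‖z‖ ^ (-1 : ℝ) * (1 + segDist z) ^ (1 - β)) := by
  set I : ℝ≥0∞ := ∫⁻ u : ℝ, ENNReal.ofReal ((1 + ‖u‖) ^ (-β)) with hId
  have hI : I < ∞ := finite_integral_one_add_norm (by simpa using hβ)
  refine ⟨2 ^ β + 2 ^ β * 4 * I.toReal, by positivity, fun z hz => ?_⟩
  have hD0 := segDist_nonneg z
  have hDR := segDist_le_norm z
  set D := segDist z
  set R := ‖z‖ with hR
  rw [Real.rpow_neg_one]
  rcases le_total ‖z.snd‖ (R / 4) with hv | hv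
  · calc _ ≤ ∫⁻ u in Set.Icc (0 : ℝ) 1, ENNReal.ofReal (2 ^ β * R⁻¹ * (1 + D) ^ (1 - β)) := by
          refine setLIntegral_mono' measurableSet_Icc fun u hu => ENNReal.ofReal_le_ofReal ?_
          have h1 := half_norm_le_of_norm_snd_le z hv hu
          calc (1 + ‖z.fst - u • z.snd‖) ^ (-β) ≤ ((1 + R) / 2) ^ (-β) := by
                refine Real.rpow_le_rpow_of_nonpos (by positivity) (by linarith) (by linarith)
            _ = 2 ^ β * ((1 + R) ^ (-1 : ℝ) * (1 + R) ^ (1 - β)) := by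
                rw [Real.div_rpow (by positivity) (by norm_num), Real.rpow_neg (by norm_num : (0 : ℝ) ≤ 2),
                  ← Real.rpow_add (by positivity)]
                rw [div_inv_eq_mul, mul_comm]
                congr 2
                ring
            _ ≤ 2 ^ β * (R⁻¹ * (1 + D) ^ (1 - β)) := by
                rw [Real.rpow_neg_one]
                gcongr ?_ * (?_ * ?_)
                · gcongr
                  linarith
                · exact Real.rpow_le_rpow_of_nonpos (by positivity) (by linarith) (by linarith)
            _ = _ := by ring
      _ = ENNReal.ofReal (2 ^ β * R⁻¹ * (1 + D) ^ (1 - β)) := by simp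
      _ ≤ _ := by
          refine ENNReal.ofReal_le_ofReal ?_
          gcongr
          have : 0 ≤ 2 ^ β * 4 * I.toReal := by positivity
          linarith
  · have hv0 : 0 < ‖z.snd‖ := by linarith
    set s₀ := ⟪z.fst, z.snd⟫ / ‖z.snd‖ ^ 2
    calc _ ≤ ∫⁻ u in Set.Icc (0 : ℝ) 1, ENNReal.ofReal (2 ^ β) *
            ENNReal.ofReal ((1 + D + ‖z.snd‖ * |u - s₀|) ^ (-β)) := by
          refine setLIntegral_mono' measurableSet_Icc fun u hu => ?_
          rw [← ENNReal.ofReal_mul (by positivity)]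
          refine ENNReal.ofReal_le_ofReal ?_
          have h1 := segDist_le z hu
          have h2 := abs_sub_mul_norm_le z.fst z.snd (norm_pos_iff.mp hv0) u
          calc (1 + ‖z.fst - u • z.snd‖) ^ (-β)
              ≤ ((1 + D + ‖z.snd‖ * |u - s₀|) / 2) ^ (-β) := by
                refine Real.rpow_le_rpow_of_nonpos (by positivity) ?_ (by linarith)
                have h3 : ‖z.snd‖ * |u - s₀| ≤ ‖z.fst - u • z.snd‖ := by rwa [mul_comm]
                linarith
            _ = _ := by
                rw [Real.div_rpow (by positivity) (by norm_num),
                  Real.rpow_neg (by norm_num : (0 : ℝ) ≤ 2), div_inv_eq_mul, mul_comm]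
      _ ≤ ∫⁻ u : ℝ, ENNReal.ofReal (2 ^ β) *
            ENNReal.ofReal ((1 + D + ‖z.snd‖ * |u - s₀|) ^ (-β)) :=
          setLIntegral_le_lintegral _ _
      _ = ENNReal.ofReal (2 ^ β) * (ENNReal.ofReal ((1 + D) ^ (1 - β) / ‖z.snd‖) * I) := by
          rw [lintegral_const_mul' _ _ ENNReal.ofReal_ne_top,
            lintegral_sub_right_eq_self (fun u : ℝ =>
              ENNReal.ofReal ((1 + D + ‖z.snd‖ * |u|) ^ (-β))) s₀,
            lintegral_add_mul_abs_rpow (by positivity) hv0]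
      _ = ENNReal.ofReal (2 ^ β * ((1 + D) ^ (1 - β) / ‖z.snd‖ * I.toReal)) := by
          rw [ENNReal.ofReal_mul (by positivity), ENNReal.ofReal_mul (by positivity),
            ENNReal.ofReal_toReal hI.ne]
      _ ≤ _ := by
          refine ENNReal.ofReal_le_ofReal ?_
          have h4 : (1 + D) ^ (1 - β) / ‖z.snd‖ ≤ (1 + D) ^ (1 - β) / (R / 4) := by gcongr
          calc _ ≤ 2 ^ β * ((1 + D) ^ (1 - β) / (R / 4) * I.toReal) := by gcongr
            _ = 2 ^ β * 4 * I.toReal * R⁻¹ * (1 + D) ^ (1 - β) := by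
                field_simp
            _ ≤ _ := by
                gcongr
                have : (0 : ℝ) ≤ 2 ^ β := by positivity
                linarith

lemma one_le_kinProfile {β : ℝ} (hβ : 1 < β) {z : WithLp 2 (E × E)} (hz : ‖z‖ ≤ 1) :
    1 ≤ 2 ^ (1 + β) * 2 ^ (β - 1) * kinProfile β z := by
  have h1 := one_le_one_add (norm_nonneg z) hz (by linarith : 0 ≤ 1 + β)
  have h2 := one_le_one_add (segDist_nonneg z) ((segDist_le_norm z).trans hz)
    (by linarith : 0 ≤ β - 1)
  calc (1 : ℝ) = 1 * 1 := (one_mul 1).symm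
    _ ≤ (2 ^ (1 + β) * (1 + ‖z‖) ^ (-(1 + β))) * (2 ^ (β - 1) * (1 + segDist z) ^ (-(β - 1))) :=
        mul_le_mul h1 h2 zero_le_one (zero_le_one.trans h1)
    _ = _ := by
        rw [kinProfile, neg_sub]
        ring

lemma kinProfile_nonneg (β : ℝ) (z : WithLp 2 (E × E)) : 0 ≤ kinProfile β z := by
  have := segDist_nonneg z
  unfold kinProfile
  positivity

lemma rpow_mul_rpow_le_kinProfile {β : ℝ} (hβ : 1 < β) {z : WithLp 2 (E × E)} (hz : 1 ≤ ‖z‖) :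
    ‖z‖ ^ (-β) * (‖z‖ ^ (-1 : ℝ) * (1 + segDist z) ^ (1 - β))
      ≤ 2 ^ (1 + β) * kinProfile β z := by
  have := segDist_nonneg z
  calc _ = ‖z‖ ^ (-(1 + β)) * (1 + segDist z) ^ (1 - β) := by
        rw [← mul_assoc, ← Real.rpow_add (by linarith)]
        congr 2
        ring
    _ ≤ (2 ^ (1 + β) * (1 + ‖z‖) ^ (-(1 + β))) * (1 + segDist z) ^ (1 - β) := by
        gcongr
        exact rpow_neg_le_one_add hz (by linarith)
    _ = _ := by rw [kinProfile]; ring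

lemma rpow_le_kinProfile {β : ℝ} (hβ : 1 < β) {z : WithLp 2 (E × E)} (hz : 1 ≤ ‖z‖) :
    ‖z‖ ^ (-(2 * β)) ≤ 2 ^ (1 + β) * 2 ^ (β - 1) * kinProfile β z := by
  have h0 := segDist_nonneg z
  have h1 := segDist_le_norm z
  calc _ = ‖z‖ ^ (-(1 + β)) * ‖z‖ ^ (-(β - 1)) := by
        rw [← Real.rpow_add (by linarith)]
        congr 1
        ring
    _ ≤ (2 ^ (1 + β) * (1 + ‖z‖) ^ (-(1 + β))) * (2 ^ (β - 1) * (1 + segDist z) ^ (-(β - 1))) := by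
        gcongr ?_ * ?_
        · exact rpow_neg_le_one_add hz (by linarith)
        · refine (rpow_neg_le_one_add hz (by linarith)).trans ?_
          gcongr ?_ * ?_
          exact Real.rpow_le_rpow_of_nonpos (by positivity) (by linarith) (by linarith)
    _ = _ := by
        rw [kinProfile, neg_sub]
        ring

end Profile

section KineticProfile

variable {E : Type*} [NormedAddCommGroup E] [InnerProductSpace ℝ E] [FiniteDimensional ℝ E]
  [MeasurableSpace E] [BorelSpace E]

lemma exists_heatApprox_le_kinProfile [Nontrivial E] {Λ : Measure E} {α B : ℝ} (hB : 0 ≤ B)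
    (hΛ : IsStableMeasure Λ α B) (hα : 0 < α) (hα2 : α < 2) :
    ∃ C : ℝ, 0 ≤ C ∧ ∀ δ > 0, ∀ τ > 0, 2 * B * δ ^ (2 - α) ≤ τ → τ ≤ 1 / 2 →
      ∀ z : WithLp 2 (E × E), heatApprox (kinMeasure (largeJumps Λ δ)) τ z ≤
        ENNReal.ofReal (C * kinProfile (Module.finrank ℝ E + α) z) := by
  obtain ⟨C₁, hC₁, h₁⟩ := exists_heatApprox_kinMeasure_le hB hΛ hα hα2
  have hd : (1 : ℝ) ≤ Module.finrank ℝ E := by exact_mod_cast Module.finrank_pos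
  set β : ℝ := Module.finrank ℝ E + α with hβd
  have hβ : 1 < β := by linarith
  obtain ⟨C₂, hC₂, h₂⟩ := exists_lintegral_segment_le (E := E) hβ
  set I : ℝ := Real.exp 0 * ∫ ζ : WithLp 2 (E × E), Real.exp (-(1 / 64 * ‖ζ‖ ^ α)) with hId
  have hI : 0 ≤ I := by
    have : 0 ≤ ∫ ζ : WithLp 2 (E × E), Real.exp (-(1 / 64 * ‖ζ‖ ^ α)) :=
      integral_nonneg fun _ => by positivity
    positivity
  set Q : ℝ := 2 ^ (1 + β) * 2 ^ (β - 1) with hQ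
  have hQ0 : 0 ≤ Q := by positivity
  set Q' : ℝ := 2 ^ (1 + β) with hQ'
  have hQ'0 : 0 ≤ Q' := by positivity
  refine ⟨I * Q + C₁ * Q + C₁ * C₂ * Q', by positivity, fun δ hδ τ hτ hτδ hτ1 z => ?_⟩
  have := hΛ.isFiniteMeasure_largeJumps hδ
  have hN := kinProfile_nonneg β z
  rcases le_total ‖z‖ 1 with hz | hz
  · have hlow : ∀ ζ : WithLp 2 (E × E), 1 / 64 * ‖ζ‖ ^ α - 0
        ≤ τ * ‖ζ‖ ^ 2 + levySymbol (kinMeasure (largeJumps Λ δ)) ζ := by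
      intro ζ
      have h1 := kinSymbol_le_add hB hΛ hα.le hδ ζ
      have h2 := kinSymbol_ge hα hα2 ζ
      have h4 : 2 * B * δ ^ (2 - α) * ‖ζ‖ ^ 2 ≤ τ * ‖ζ‖ ^ 2 := by gcongr
      linarith
    refine (heatApprox_le_const (map_neg_kinMeasure (hΛ.map_neg_largeJumps δ)) hτ (by norm_num)
      hα hlow z).trans (ENNReal.ofReal_le_ofReal ?_)
    rw [← hId]
    calc I = I * 1 := (mul_one I).symm
      _ ≤ I * (Q * kinProfile β z) := by
          gcongr
          exact one_le_kinProfile hβ hz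
      _ = I * Q * kinProfile β z := by ring
      _ ≤ _ := by
          gcongr
          have : 0 ≤ C₁ * Q + C₁ * C₂ * Q' := by positivity
          linarith
  · have hD := segDist_nonneg z
    refine (h₁ δ hδ τ hτ hτδ hτ1 z hz).trans ?_
    refine (add_le_add le_rfl (mul_le_mul' le_rfl (h₂ z (by linarith)))).trans ?_
    rw [← ENNReal.ofReal_mul (by positivity), ← ENNReal.ofReal_add (by positivity) (by positivity)]
    refine ENNReal.ofReal_le_ofReal ?_
    calc _ = C₁ * ‖z‖ ^ (-(2 * β)) +
          C₁ * C₂ * (‖z‖ ^ (-β) * (‖z‖ ^ (-1 : ℝ) * (1 + segDist z) ^ (1 - β))) := by ring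
      _ ≤ C₁ * (Q * kinProfile β z) + C₁ * C₂ * (Q' * kinProfile β z) := by
          gcongr C₁ * ?_ + C₁ * C₂ * ?_
          · exact rpow_le_kinProfile hβ hz
          · exact rpow_mul_rpow_le_kinProfile hβ hz
      _ = (C₁ * Q + C₁ * C₂ * Q') * kinProfile β z := by ring
      _ ≤ _ := by
          gcongr
          have : 0 ≤ I * Q := by positivity
          linarith

end KineticProfile

section Limit

variable {E : Type*} [NormedAddCommGroup E] [InnerProductSpace ℝ E] [FiniteDimensional ℝ E]
  [MeasurableSpace E] [BorelSpace E]

lemma tendsto_integral_largeJumps {Λ : Measure E} {α B : ℝ} (hB : 0 ≤ B)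
    (hΛ : IsStableMeasure Λ α B) (hα : 0 < α) (hα2 : α < 2) {δ τ : ℕ → ℝ} (hδ : ∀ n, 0 < δ n)
    (hτδ : ∀ n, 2 * B * δ n ^ (2 - α) ≤ τ n)
    (hτ0 : Filter.Tendsto τ Filter.atTop (nhds 0)) (z : WithLp 2 (E × E)) :
    Filter.Tendsto (fun n => ∫ ζ, Real.cos ⟪z, ζ⟫ *
        Real.exp (-(τ n * ‖ζ‖ ^ 2 + levySymbol (kinMeasure (largeJumps Λ (δ n))) ζ)))
      Filter.atTop (nhds (∫ ζ, Real.cos ⟪z, ζ⟫ * Real.exp (-kinSymbol α ζ))) := by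
  have hfin := fun n => hΛ.isFiniteMeasure_largeJumps (hδ n)
  have hle : ∀ n (ζ : WithLp 2 (E × E)), kinSymbol α ζ ≤
      τ n * ‖ζ‖ ^ 2 + levySymbol (kinMeasure (largeJumps Λ (δ n))) ζ := by
    intro n ζ
    have h1 := kinSymbol_le_add hB hΛ hα.le (hδ n) ζ
    have h4 : 2 * B * δ n ^ (2 - α) * ‖ζ‖ ^ 2 ≤ τ n * ‖ζ‖ ^ 2 := by
      gcongr
      exact hτδ n
    linarith
  refine tendsto_integral_of_dominated_convergence
    (fun ζ : WithLp 2 (E × E) => Real.exp (-(1 / 64 * ‖ζ‖ ^ α))) ?_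
    (integrable_exp_neg_norm_rpow (by norm_num) hα) ?_ ?_
  · intro n
    have := measurable_levySymbol (kinMeasure (largeJumps Λ (δ n)))
    exact (by fun_prop : Measurable _).aestronglyMeasurable
  · intro n
    filter_upwards with ζ
    rw [norm_mul, Real.norm_eq_abs, Real.norm_eq_abs, Real.abs_exp]
    refine (mul_le_of_le_one_left (by positivity) (Real.abs_cos_le_one _)).trans ?_
    gcongr
    exact (kinSymbol_ge hα hα2 ζ).trans (hle n ζ)
  · filter_upwards with ζ
    have hsq : Filter.Tendsto (fun n => τ n * ‖ζ‖ ^ 2 +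
        levySymbol (kinMeasure (largeJumps Λ (δ n))) ζ) Filter.atTop (nhds (kinSymbol α ζ)) := by
      refine tendsto_of_tendsto_of_tendsto_of_le_of_le (g := fun _ => kinSymbol α ζ)
        (h := fun n => τ n * ‖ζ‖ ^ 2 + kinSymbol α ζ) tendsto_const_nhds ?_
        (fun n => hle n ζ) (fun n => ?_)
      · simpa using (hτ0.mul_const (‖ζ‖ ^ 2)).add_const (kinSymbol α ζ)
      · have := levySymbol_kinMeasure_le hΛ hα.le (hδ n) ζ
        simp only
        linarith
    exact (((Real.continuous_exp.tendsto _).comp hsq.neg)).const_mul _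

lemma exists_integral_kinSymbol_le [Nontrivial E] {α : ℝ} (hα : 0 < α) (hα2 : α < 2) :
    ∃ C : ℝ, 0 ≤ C ∧ ∀ z : WithLp 2 (E × E),
      ∫ ζ, Real.cos ⟪z, ζ⟫ * Real.exp (-kinSymbol α ζ)
        ≤ C * kinProfile (Module.finrank ℝ E + α) z := by
  obtain ⟨Λ, B, hB, hΛ⟩ := exists_isStableMeasure E hα hα2
  obtain ⟨C, hC, h⟩ := exists_heatApprox_le_kinProfile hB hΛ hα hα2
  refine ⟨C, hC, fun z => ?_⟩
  set δ : ℕ → ℝ := fun n => 1 / ((n : ℝ) + 1) with hδd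
  set τ : ℕ → ℝ := fun n => (2 * B + 1) * δ n ^ (2 - α) with hτd
  have hδ : ∀ n, 0 < δ n := fun n => by positivity
  have hτ : ∀ n, 0 < τ n := fun n => mul_pos (by positivity) (Real.rpow_pos_of_pos (hδ n) _)
  have hτδ : ∀ n, 2 * B * δ n ^ (2 - α) ≤ τ n := fun n =>
    mul_le_mul_of_nonneg_right (by linarith) (Real.rpow_pos_of_pos (hδ n) _).le
  have hτ0 : Filter.Tendsto τ Filter.atTop (nhds 0) := by
    have h1 := (tendsto_one_div_add_atTop_nhds_zero_nat (𝕜 := ℝ)).rpow_const (p := 2 - α)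
      (Or.inr (by linarith))
    rw [Real.zero_rpow (by linarith)] at h1
    have h2 := h1.const_mul (2 * B + 1)
    rwa [mul_zero] at h2
  refine le_of_tendsto (tendsto_integral_largeJumps hB hΛ hα hα2 hδ hτδ hτ0 z) ?_
  filter_upwards [hτ0.eventually_le_const (by norm_num : (0 : ℝ) < 1 / 2)] with n hn
  have := hΛ.isFiniteMeasure_largeJumps (hδ n)
  have h2 := h (δ n) (hδ n) (τ n) (hτ n) (hτδ n) hn z
  rw [heatApprox_eq (map_neg_kinMeasure (hΛ.map_neg_largeJumps (δ n))) (hτ n)] at h2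
  exact (ENNReal.ofReal_le_ofReal_iff (mul_nonneg hC (kinProfile_nonneg _ z))).mp h2

lemma integral_comp_smul_prod (g : E × E → ℝ) {a b : ℝ} (ha : 0 < a) (hb : 0 < b) :
    ∫ w : E × E, g w
      = a ^ Module.finrank ℝ E * b ^ Module.finrank ℝ E * ∫ w : E × E, g (a • w.1, b • w.2) := by
  set d := Module.finrank ℝ E
  let e : E × E ≃ₜ E × E := (Homeomorph.smulOfNeZero a ha.ne').prodCongr
    (Homeomorph.smulOfNeZero b hb.ne')
  have he : (volume : Measure (E × E)).map e
      = (ENNReal.ofReal (a ^ d)⁻¹ * ENNReal.ofReal (b ^ d)⁻¹) • volume := by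
    have h1 : (e : E × E → E × E) = Prod.map (fun y => a • y) (fun y => b • y) := rfl
    rw [h1, Measure.volume_eq_prod, ← Measure.map_prod_map _ _ (by fun_prop) (by fun_prop),
      Measure.map_addHaar_smul _ ha.ne', Measure.map_addHaar_smul _ hb.ne',
      Measure.prod_smul_left, Measure.prod_smul_right, smul_smul,
      abs_of_pos (by positivity), abs_of_pos (by positivity)]
  have h2 : ∫ w : E × E, g (e w) = ((a ^ d)⁻¹ * (b ^ d)⁻¹) * ∫ w : E × E, g w := by
    rw [← e.measurableEmbedding.integral_map g, he, integral_smul_measure, ENNReal.toReal_mul,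
      ENNReal.toReal_ofReal (by positivity), ENNReal.toReal_ofReal (by positivity), smul_eq_mul]
  have h3 : ∀ w : E × E, e w = (a • w.1, b • w.2) := fun _ => rfl
  simp_rw [h3] at h2
  rw [h2]
  field_simp

lemma integral_norm_rpow_scaling {α t : ℝ} (hα : 0 < α) (ht : 0 < t) (ξ η : E) :
    ∫ s in (0 : ℝ)..t, ‖s • t ^ (-α⁻¹ - 1) • ξ + t ^ (-α⁻¹) • η‖ ^ α
      = ∫ s in (0 : ℝ)..1, ‖s • ξ + η‖ ^ α := by
  have h1 : ∀ s : ℝ, ‖s • t ^ (-α⁻¹ - 1) • ξ + t ^ (-α⁻¹) • η‖ ^ α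
      = t⁻¹ * ‖(s / t) • ξ + η‖ ^ α := by
    intro s
    have h2 : s • t ^ (-α⁻¹ - 1) • ξ + t ^ (-α⁻¹) • η
        = t ^ (-α⁻¹) • ((s / t) • ξ + η) := by
      rw [smul_add, smul_smul, smul_smul, Real.rpow_sub ht, Real.rpow_one]
      congr 2
      ring
    rw [h2, norm_smul, Real.norm_of_nonneg (by positivity),
      Real.mul_rpow (by positivity) (norm_nonneg _), ← Real.rpow_mul ht.le, neg_mul,
      inv_mul_cancel₀ hα.ne', Real.rpow_neg_one]
  simp_rw [h1]
  rw [intervalIntegral.integral_const_mul,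
    intervalIntegral.integral_comp_div (fun s => ‖s • ξ + η‖ ^ α) ht.ne', zero_div,
    div_self ht.ne', smul_eq_mul, inv_mul_cancel_left₀ ht.ne']

end Limit

lemma kinHeat_eq_scaled (d : ℕ) {α t : ℝ} (hα : 0 < α) (ht : 0 < t)
    (x v : EuclideanSpace ℝ (Fin d)) :
    kinHeat d α t x v = t ^ (-(2 * (d : ℝ)) / α - d) *
      kinHeat d α 1 (t ^ (-α⁻¹ - 1) • x) (t ^ (-α⁻¹) • v) := by
  unfold kinHeat
  rw [integral_comp_smul_prod _ (Real.rpow_pos_of_pos ht (-α⁻¹ - 1))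
    (Real.rpow_pos_of_pos ht (-α⁻¹))]
  simp only [integral_norm_rpow_scaling hα ht, inner_smul_left, inner_smul_right, conj_trivial,
    finrank_euclideanSpace, Fintype.card_fin]
  rw [← Real.rpow_natCast, ← Real.rpow_natCast, ← Real.rpow_mul ht.le, ← Real.rpow_mul ht.le,
    ← Real.rpow_add ht]
  have : (-α⁻¹ - 1) * (d : ℝ) + -α⁻¹ * (d : ℝ) = -(2 * (d : ℝ)) / α - d := by
    field_simp
    ring
  rw [this]
  ring

lemma kinHeat_one_eq (d : ℕ) (α : ℝ) (x v : EuclideanSpace ℝ (Fin d)) :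
    kinHeat d α 1 x v = (2 * π) ^ (-(2 * (d : ℝ))) *
      ∫ ζ, Real.cos ⟪WithLp.toLp 2 (x, v), ζ⟫ * Real.exp (-kinSymbol α ζ) := by
  unfold kinHeat
  congr 1
  rw [← (WithLp.volume_preserving_toLp (EuclideanSpace ℝ (Fin d))
    (EuclideanSpace ℝ (Fin d))).integral_comp (MeasurableEquiv.toLp 2 _).measurableEmbedding]
  rfl

lemma kinN_eq_kinProfile (d : ℕ) (β : ℝ) (x v : EuclideanSpace ℝ (Fin d)) :
    kinN d β x v = kinProfile β (WithLp.toLp 2 (x, v)) := by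
  rw [kinProfile, WithLp.prod_norm_eq_of_L2]
  rfl

/-- sharp upper bound for the kinetic heat kernel. -/
theorem stmt_2 (d : ℕ) (hd : 1 ≤ d) (α : ℝ) (hα : α ∈ Set.Ioo (0 : ℝ) 2) :
    ∃ C ≥ (1 : ℝ), ∀ t > (0 : ℝ), ∀ x v : EuclideanSpace ℝ (Fin d),
      kinHeat d α t x v ≤
        C * t ^ (-(2 * (d : ℝ)) / α - d) *
          kinN d ((d : ℝ) + α) ((t ^ (-α⁻¹ - 1)) • x) ((t ^ (-α⁻¹)) • v) := by
  have : Nonempty (Fin d) := ⟨⟨0, hd⟩⟩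
  obtain ⟨C, hC, h⟩ := exists_integral_kinSymbol_le (E := EuclideanSpace ℝ (Fin d)) hα.1 hα.2
  set P : ℝ := (2 * π) ^ (-(2 * (d : ℝ)))
  have hP : 0 ≤ P := by positivity
  refine ⟨P * C + 1, by linarith [mul_nonneg hP hC], fun t ht x v => ?_⟩
  rw [kinHeat_eq_scaled d hα.1 ht, kinHeat_one_eq, kinN_eq_kinProfile]
  have h1 := h (WithLp.toLp 2 (t ^ (-α⁻¹ - 1) • x, t ^ (-α⁻¹) • v))
  rw [finrank_euclideanSpace, Fintype.card_fin] at h1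
  have h2 := kinProfile_nonneg ((d : ℝ) + α)
    (WithLp.toLp 2 (t ^ (-α⁻¹ - 1) • x, t ^ (-α⁻¹) • v))
  have h3 : (0 : ℝ) ≤ t ^ (-(2 * (d : ℝ)) / α - d) := by positivity
  set N := kinProfile ((d : ℝ) + α) (WithLp.toLp 2 (t ^ (-α⁻¹ - 1) • x, t ^ (-α⁻¹) • v))
  calc _ ≤ t ^ (-(2 * (d : ℝ)) / α - d) * (P * (C * N)) := by gcongr
    _ ≤ t ^ (-(2 * (d : ℝ)) / α - d) * ((P * C + 1) * N) := by
        rw [← mul_assoc P]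
        gcongr
        linarith
    _ = _ := by ring
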